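/- arXiv:1205.5090 — 2 statements merged into one kernel-verified Lean document; each statement's English description precedes it below -/
import Mathlib

section
/- Let G be a free group of finite rank r with free generating set S, acting on a standard Borel probability space (X, μ) by μ-preserving Borel automorphisms, and let Σ be a G-invariant sub-σ-algebra. Suppose f_G(X, μ/Σ) is defined and f_G(X, μ/Σ) ≠ −∞. Then for every generating partition α with H(α) < ∞, lim_{n→∞} ∑_{g ∈ G, |g| ≥ 2} δ(g, B_n·α / Σ) = 0. -/
open MeasureTheory Filter Set
open scoped ENNReal symmDiff Pointwise

namespace FPaper

/-- The free group of rank `r`; its free generating set `S` is `{FreeGroup.of i | i : Fin r}`. -/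
abbrev FG (r : ℕ) := FreeGroup (Fin r)

/-- The reduced `S`-word length of a group element. -/
def wlen {r : ℕ} (g : FG r) : ℕ := g.toWord.length

/-- The ball of radius `n` in `FG r` with respect to the word length. -/
def ball (r n : ℕ) : Set (FG r) := {g | wlen g ≤ n}

instance ballFinite (r n : ℕ) : Finite (ball r n) := by
  have h : ball r n ⊆ FreeGroup.mk '' {l : List (Fin r × Bool) | l.length ≤ n} :=
    fun g hg => ⟨g.toWord, hg, FreeGroup.mk_toWord⟩
  exact (((List.finite_length_le _ n).image _).subset h).to_subtype

/-- An action of a group `G` on a measurable space `X` by Borel automorphisms. -/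
structure BorelAction (G : Type*) [Group G] (X : Type*) [MeasurableSpace X] where
  act : G → X → X
  act_one : ∀ x, act 1 x = x
  act_mul : ∀ g h x, act (g * h) x = act g (act h x)
  measurable_act : ∀ g, Measurable (act g)

namespace BorelAction

variable {G X : Type*} [Group G] [mX : MeasurableSpace X]

/-- The action preserves the measure `μ`. -/
def Preserves (T : BorelAction G X) (μ : Measure X) : Prop :=
  ∀ g : G, MeasurePreserving (T.act g) μ μ

/-- The translated set `g · B`. -/
def smulSet (T : BorelAction G X) (g : G) (B : Set X) : Set X := T.act g⁻¹ ⁻¹' B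

/-- The translated partition `g · α`, where a countable measurable partition is recorded
by a (measurable, countably-valued) function whose fibers are the cells. -/
def tr {I : Type*} (T : BorelAction G X) (g : G) (a : X → I) : X → I :=
  fun x => a (T.act g⁻¹ x)

/-- The join `F · α = ⋁_{f ∈ F} f · α` of the translates of a partition over a set `F ⊆ G`. -/
def joinF {I : Type*} (T : BorelAction G X) (F : Set G) (a : X → I) : X → (F → I) :=
  fun x f => a (T.act (f : G)⁻¹ x)

/-- The σ-algebra generated by the partitions `f · α`, `f ∈ F`. -/
def partSA {I : Type*} (T : BorelAction G X) (F : Set G) (a : X → I) : MeasurableSpace X :=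
  ⨆ f ∈ F, MeasurableSpace.comap (T.tr f a) ⊤

/-- The partition `a` is generating: the smallest `G`-invariant σ-algebra containing `a`
(i.e. the one generated by all translates of `a`) contains every measurable set up to
`ν`-null sets. -/
def Generating {I : Type*} (T : BorelAction G X) (a : X → I) (ν : Measure X) : Prop :=
  ∀ B : Set X, MeasurableSet B →
    ∃ B', MeasurableSet[T.partSA Set.univ a] B' ∧ ν (B ∆ B') = 0


/-- Ergodicity of the action with respect to `ν`. -/
def IsErgodic (T : BorelAction G X) (ν : Measure X) : Prop :=
  ∀ B : Set X, MeasurableSet B → (∀ g : G, ν (T.smulSet g B ∆ B) = 0) → ν B = 0 ∨ ν B = 1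

/-- The action is essentially free with respect to `ν`. -/
def EssentiallyFree (T : BorelAction G X) (ν : Measure X) : Prop :=
  ν {x | ∀ g : G, g ≠ 1 → T.act g x ≠ x} = 1

/-- The stabilizer subgroup of a point. -/
def stab (T : BorelAction G X) (y : X) : Subgroup G where
  carrier := {g | T.act g y = y}
  one_mem' := T.act_one y
  mul_mem' := by
    intro g h hg hh
    simp only [Set.mem_setOf_eq] at *
    rw [T.act_mul, hh, hg]
  inv_mem' := by
    intro g hg
    simp only [Set.mem_setOf_eq] at *
    conv_lhs => rw [← hg]
    rw [← T.act_mul, inv_mul_cancel, T.act_one]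

end BorelAction

/-- `m` is a `G`-invariant sub-σ-algebra. -/
def InvariantSA {G X : Type*} [Group G] (m : MeasurableSpace X) [mX : MeasurableSpace X]
    (T : BorelAction G X) : Prop :=
  m ≤ mX ∧ ∀ (g : G) (B : Set X), MeasurableSet[m] B → MeasurableSet[m] (T.act g ⁻¹' B)

/-- A measure is purely atomic: the set of atoms has full measure. -/
def PurelyAtomic {X : Type*} [MeasurableSpace X] (ν : Measure X) : Prop :=
  ν {x | 0 < ν {x}} = 1

/-- Shannon entropy of a countable measurable partition (recorded as a countably-valued
function), with values in `[0, ∞]`. -/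
noncomputable def Hpart {X I : Type*} [MeasurableSpace X] [Countable I]
    (μ : Measure X) (a : X → I) : ℝ≥0∞ :=
  ∑' i : I, ENNReal.ofReal (Real.negMulLog (μ (a ⁻¹' {i})).toReal)

/-- Conditional Shannon entropy of a countable partition given a sub-σ-algebra `m`:
`H(α/m) = ∫ ∑_{A ∈ α} φ(E[1_A | m](x)) dμ(x)` with `φ(t) = -t log t`. -/
noncomputable def condEntS {X I : Type*} (m : MeasurableSpace X) [mX : MeasurableSpace X]
    [Countable I] (μ : Measure X) (a : X → I) : ℝ≥0∞ :=
  ∫⁻ x, ∑' i : I,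
    ENNReal.ofReal (Real.negMulLog ((μ[(a ⁻¹' {i}).indicator (fun _ => (1:ℝ)) | m]) x)) ∂μ

/-- Conditional Shannon entropy of a partition given another partition:
`H(α/β) = ∑_{B ∈ β} ∑_{A ∈ α} -μ(B) · (μ(A∩B)/μ(B)) · log (μ(A∩B)/μ(B))`
(equivalently `H(α ∨ β) − H(β)`), with values in `[0, ∞]`. -/
noncomputable def condEntP {X I J : Type*} [MeasurableSpace X] [Countable I] [Countable J]
    (μ : Measure X) (a : X → I) (b : X → J) : ℝ≥0∞ :=
  ∑' q : I × J, μ (b ⁻¹' {q.2}) *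
    ENNReal.ofReal (Real.negMulLog
      ((μ (a ⁻¹' {q.1} ∩ b ⁻¹' {q.2})).toReal / (μ (b ⁻¹' {q.2})).toReal))

/-- `F_G(X, μ, S, β) = (1-2r)·H(β) + ∑_{s ∈ S} H(s·β ∨ β)`. -/
noncomputable def FF {r : ℕ} {X I : Type*} [MeasurableSpace X] [Countable I]
    (μ : Measure X) (T : BorelAction (FG r) X) (b : X → I) : ℝ :=
  (1 - 2 * (r : ℝ)) * (Hpart μ b).toReal
    + ∑ i : Fin r, (Hpart μ (fun x => (T.tr (FreeGroup.of i) b x, b x))).toReal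

/-- The sequence `n ↦ F_G(X, μ, S, B_n · α)`. -/
noncomputable def fSeq {r : ℕ} {X : Type*} [MeasurableSpace X]
    (μ : Measure X) (T : BorelAction (FG r) X) (a : X → ℕ) (n : ℕ) : ℝ :=
  FF μ T (T.joinF (ball r n) a)

/-- The f-invariant entropy `f_G(X, μ) = lim_n F_G(X, μ, S, B_n·α)`, the limit (= infimum,
since the sequence is non-increasing) of the sequence `fSeq`, with values in `[-∞, ∞)`. -/
noncomputable def fInv {r : ℕ} {X : Type*} [MeasurableSpace X]
    (μ : Measure X) (T : BorelAction (FG r) X) (a : X → ℕ) : EReal :=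
  ⨅ n : ℕ, ((fSeq μ T a n : ℝ) : EReal)

/-- Relative version `F_G(X, μ/Σ, S, β) = (1-2r)·H(β/Σ) + ∑_{s ∈ S} H(s·β ∨ β / Σ)`. -/
noncomputable def FFrel {r : ℕ} {X I : Type*} (m : MeasurableSpace X) [mX : MeasurableSpace X]
    [Countable I] (μ : Measure X) (T : BorelAction (FG r) X) (b : X → I) : ℝ :=
  (1 - 2 * (r : ℝ)) * (condEntS m μ b).toReal
    + ∑ i : Fin r, (condEntS m μ (fun x => (T.tr (FreeGroup.of i) b x, b x))).toReal

/-- The sequence `n ↦ F_G(X, μ/Σ, S, B_n · α)`. -/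
noncomputable def fSeqRel {r : ℕ} {X : Type*} (m : MeasurableSpace X) [mX : MeasurableSpace X]
    (μ : Measure X) (T : BorelAction (FG r) X) (a : X → ℕ) (n : ℕ) : ℝ :=
  FFrel m μ T (T.joinF (ball r n) a)

/-- The relative f-invariant entropy `f_G(X, μ/Σ)`, with values in `[-∞, ∞)`. -/
noncomputable def fInvRel {r : ℕ} {X : Type*} (m : MeasurableSpace X) [mX : MeasurableSpace X]
    (μ : Measure X) (T : BorelAction (FG r) X) (a : X → ℕ) : EReal :=
  ⨅ n : ℕ, ((fSeqRel m μ T a n : ℝ) : EReal)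

/-- A total order on `S ∪ S⁻¹` is recorded by an injection `ord : Fin r × Bool → ℕ`;
`g ≺ h` iff `|g| < |h|`, or `|g| = |h|` and the reduced word of `g` lexicographically
precedes that of `h`. -/
def wlt {r : ℕ} (ord : Fin r × Bool → ℕ) (g h : FG r) : Prop :=
  wlen g < wlen h ∨ (wlen g = wlen h ∧ List.Lex (fun p q => ord p < ord q) g.toWord h.toWord)

/-- `Pre(g)`: the set of elements strictly preceding `g`. -/
def Pre {r : ℕ} (ord : Fin r × Bool → ℕ) (g : FG r) : Set (FG r) := {h | wlt ord h g}

/-- The generator or inverse generator corresponding to a letter. -/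
def letter {r : ℕ} (p : Fin r × Bool) : FG r :=
  if p.2 then FreeGroup.of p.1 else (FreeGroup.of p.1)⁻¹

/-- The first (leftmost) letter of the reduced word of `g` (junk value `1` for `g = 1`). -/
def firstLetter {r : ℕ} (g : FG r) : FG r := ((g.toWord.head?).map letter).getD 1

/-- The independence decay `δ(g, α/Σ)`, as a real number:
`δ(g, α/Σ) = H(s⁻¹g·α / Pre(s⁻¹g)·α ∨ Σ) − H(g·α / Pre(g)·α ∨ Σ)` where `s` is the first
letter of `g`. -/
noncomputable def idecay {r : ℕ} {X I : Type*} (m : MeasurableSpace X) [mX : MeasurableSpace X]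
    [Countable I] (μ : Measure X) (T : BorelAction (FG r) X)
    (ord : Fin r × Bool → ℕ) (a : X → I) (g : FG r) : ℝ :=
  (condEntS (m ⊔ T.partSA (Pre ord ((firstLetter g)⁻¹ * g)) a) μ
      (T.tr ((firstLetter g)⁻¹ * g) a)).toReal
  - (condEntS (m ⊔ T.partSA (Pre ord g) a) μ (T.tr g a)).toReal

/-- The entropy `H(τ)` of a probability space: the supremum of the Shannon entropies of
finite measurable partitions. -/
noncomputable def measEnt {M : Type*} [MeasurableSpace M] (τ : Measure M) : ℝ≥0∞ :=
  ⨆ (P : Finset (Set M)) (_ : ∀ p ∈ P, MeasurableSet p)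
    (_ : (P : Set (Set M)).PairwiseDisjoint id) (_ : ⋃₀ (P : Set (Set M)) = Set.univ),
    ∑ p ∈ P, ENNReal.ofReal (Real.negMulLog (τ p).toReal)

/-- The non-negative part of an extended real, in `ℝ≥0∞`. -/
noncomputable def erealToENNReal (x : EReal) : ℝ≥0∞ :=
  if x = ⊤ then ⊤ else ENNReal.ofReal x.toReal

/-- The integral of an `EReal`-valued function (positive part minus negative part),
with values in `[-∞, ∞]`. -/
noncomputable def eIntegral {M : Type*} [MeasurableSpace M] (τ : Measure M) (f : M → EReal) :
    EReal :=
  ((∫⁻ m, erealToENNReal (f m) ∂τ : ℝ≥0∞) : EReal)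
    - ((∫⁻ m, erealToENNReal (-(f m)) ∂τ : ℝ≥0∞) : EReal)

/-- The set of `G`-invariant Borel probability measures on `X`. -/
def InvProb {G X : Type*} [Group G] [MeasurableSpace X] (T : BorelAction G X) :
    Set (Measure X) :=
  {ν | IsProbabilityMeasure ν ∧ ∀ g : G, MeasurePreserving (T.act g) ν ν}

section

open ProbabilityTheory

variable {X : Type*} {m m' : MeasurableSpace X} [mX : MeasurableSpace X] {μ : Measure X}

lemma condProb_mem_Icc [IsProbabilityMeasure μ] (hm : m ≤ mX) {B : Set X} (hB : MeasurableSet B) :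
    ∀ᵐ x ∂μ, (μ[B.indicator (fun _ => (1 : ℝ)) | m]) x ∈ Icc (0 : ℝ) 1 := by
  have hi : Integrable (B.indicator (fun _ => (1 : ℝ))) μ :=
    (integrable_const (1 : ℝ)).indicator hB
  have h0 : 0 ≤ᵐ[μ] μ[B.indicator (fun _ => (1 : ℝ)) | m] :=
    condExp_nonneg (Eventually.of_forall fun x => indicator_nonneg (fun _ _ => zero_le_one) x)
  have h1 : μ[B.indicator (fun _ => (1 : ℝ)) | m] ≤ᵐ[μ] μ[fun _ => (1 : ℝ) | m] :=
    condExp_mono hi (integrable_const 1)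
      (Eventually.of_forall fun x => indicator_le_self' (fun _ _ => zero_le_one) x)
  rw [condExp_const hm] at h1
  filter_upwards [h0, h1] with x hx0 hx1 using ⟨hx0, hx1⟩

lemma abs_negMulLog_le_one {t : ℝ} (ht : t ∈ Icc (0 : ℝ) 1) : |Real.negMulLog t| ≤ 1 := by
  rw [abs_of_nonneg (Real.negMulLog_nonneg ht.1 ht.2)]
  linarith [Real.negMulLog_le_one_sub_self ht.1, ht.1]

lemma aemeasurable_condProb (hm : m ≤ mX) (B : Set X) :
    AEMeasurable (μ[B.indicator (fun _ => (1 : ℝ)) | m]) μ :=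
  ((stronglyMeasurable_condExp (m := m)).mono hm).measurable.aemeasurable

lemma integrable_negMulLog_condProb [IsProbabilityMeasure μ] (hm : m ≤ mX) {B : Set X}
    (hB : MeasurableSet B) :
    Integrable (Real.negMulLog ∘ μ[B.indicator (fun _ => (1 : ℝ)) | m]) μ := by
  refine Integrable.of_bound
    (Real.continuous_negMulLog.measurable.comp_aemeasurable
      (aemeasurable_condProb hm B)).aestronglyMeasurable 1 ?_
  filter_upwards [condProb_mem_Icc hm hB] with x hx using abs_negMulLog_le_one hx

/-- The contribution of a single cell to the conditional entropy decreases when the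
conditioning σ-algebra grows. -/
lemma lintegral_negMulLog_condProb_anti [IsProbabilityMeasure μ]
    (hmm : m ≤ m') (hm' : m' ≤ mX) {B : Set X} (hB : MeasurableSet B) :
    ∫⁻ x, ENNReal.ofReal (Real.negMulLog ((μ[B.indicator (fun _ => (1 : ℝ)) | m']) x)) ∂μ ≤
      ∫⁻ x, ENNReal.ofReal (Real.negMulLog ((μ[B.indicator (fun _ => (1 : ℝ)) | m]) x)) ∂μ := by
  have hm : m ≤ mX := hmm.trans hm'
  set q := μ[B.indicator (fun _ => (1 : ℝ)) | m'] with hq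
  set p := μ[B.indicator (fun _ => (1 : ℝ)) | m] with hp
  have hqp : μ[q | m] =ᵐ[μ] p := condExp_condExp_of_le hmm hm'
  have hiq := integrable_negMulLog_condProb (μ := μ) hm' hB
  have hip := integrable_negMulLog_condProb (μ := μ) hm hB
  have hJ : μ[Real.negMulLog ∘ q | m] ≤ᵐ[μ] Real.negMulLog ∘ μ[q | m] :=
    Real.concaveOn_negMulLog.condExp_map_le hm
      (Real.continuous_negMulLog.upperSemicontinuous.upperSemicontinuousOn _)
      ((condProb_mem_Icc hm' hB).mono fun x hx => hx.1) isClosed_Ici integrable_condExp hiq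
  have hle : ∫ x, Real.negMulLog (q x) ∂μ ≤ ∫ x, Real.negMulLog (p x) ∂μ := by
    calc ∫ x, Real.negMulLog (q x) ∂μ = ∫ x, (μ[Real.negMulLog ∘ q | m]) x ∂μ :=
          (integral_condExp hm).symm
      _ ≤ ∫ x, Real.negMulLog (p x) ∂μ := by
          refine integral_mono_ae integrable_condExp hip ?_
          filter_upwards [hJ, hqp] with x h1 h2
          simpa [h2] using h1
  change ∫⁻ x, ENNReal.ofReal ((Real.negMulLog ∘ q) x) ∂μ ≤
    ∫⁻ x, ENNReal.ofReal ((Real.negMulLog ∘ p) x) ∂μ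
  rw [← ofReal_integral_eq_lintegral_ofReal hiq, ← ofReal_integral_eq_lintegral_ofReal hip]
  · exact ENNReal.ofReal_le_ofReal hle
  · filter_upwards [condProb_mem_Icc hm hB] with x hx using Real.negMulLog_nonneg hx.1 hx.2
  · filter_upwards [condProb_mem_Icc hm' hB] with x hx using Real.negMulLog_nonneg hx.1 hx.2

lemma condEntS_eq_tsum {I : Type*} [Countable I] (hm : m ≤ mX) (a : X → I) :
    condEntS m μ a = ∑' i, ∫⁻ x, ENNReal.ofReal
      (Real.negMulLog ((μ[(a ⁻¹' {i}).indicator (fun _ => (1 : ℝ)) | m]) x)) ∂μ :=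
  lintegral_tsum fun _ => (Real.continuous_negMulLog.measurable.comp_aemeasurable
    (aemeasurable_condProb hm _)).ennreal_ofReal

lemma condEntS_anti [IsProbabilityMeasure μ] {I : Type*} [Countable I]
    (hmm : m ≤ m') (hm' : m' ≤ mX) {a : X → I} (ha : Measurable[mX, ⊤] a) :
    condEntS m' μ a ≤ condEntS m μ a := by
  rw [condEntS_eq_tsum hm', condEntS_eq_tsum (hmm.trans hm')]
  exact ENNReal.tsum_le_tsum fun i => lintegral_negMulLog_condProb_anti hmm hm' (ha trivial)

lemma condEntS_le_Hpart [IsProbabilityMeasure μ] {I : Type*} [Countable I]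
    (hm : m ≤ mX) {a : X → I} (ha : Measurable[mX, ⊤] a) :
    condEntS m μ a ≤ Hpart μ a := by
  refine (condEntS_anti bot_le hm ha).trans (le_of_eq ?_)
  rw [condEntS_eq_tsum bot_le]
  refine tsum_congr fun i => ?_
  have hi : MeasurableSet (a ⁻¹' {i}) := ha trivial
  simp [condExp_bot, integral_indicator hi, measureReal_def]

/-- Conditional entropy is the average entropy of the conditional measures. -/
lemma condEntS_eq_lintegral_Hpart [StandardBorelSpace X] [IsProbabilityMeasure μ]
    {I : Type*} [Countable I] (hm : m ≤ mX) {a : X → I} (ha : Measurable[mX, ⊤] a) :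
    condEntS m μ a = ∫⁻ x, Hpart (condExpKernel μ m x) a ∂μ := by
  refine lintegral_congr_ae ?_
  have h : ∀ i, (fun x => (condExpKernel μ m x).real (a ⁻¹' {i})) =ᵐ[μ]
      μ[(a ⁻¹' {i}).indicator (fun _ => (1 : ℝ)) | m] := fun i =>
    condExpKernel_ae_eq_condExp hm (ha trivial)
  filter_upwards [ae_all_iff.2 h] with x hx
  exact tsum_congr fun i => by rw [← hx i, measureReal_def]

lemma setLIntegral_condExpKernel_apply [StandardBorelSpace X] [IsProbabilityMeasure μ]
    (hm : m ≤ mX) {A M : Set X} (hA : MeasurableSet A) (hM : MeasurableSet[m] M) :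
    ∫⁻ x in M, condExpKernel μ m x A ∂μ = μ (M ∩ A) := by
  have h := compProd_trim_condExpKernel (μ := μ) hm
  have h2 := congrArg (fun ν => ν (M ×ˢ A)) h
  beta_reduce at h2
  rw [@Measure.compProd_apply_prod X X m mX _ _ _ _ _ _ hM hA,
    Measure.map_apply (f := Function.diag) (measurable_id'' hm |>.prodMk measurable_id)
      (hM.prod hA)] at h2
  rw [← setLIntegral_trim hm (measurable_condExpKernel hA) hM, h2]
  rfl

/-- Averaging a Σ-measurable function over a set against the conditional probability. -/
lemma lintegral_condExpKernel_mul [StandardBorelSpace X] [IsProbabilityMeasure μ]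
    (hm : m ≤ mX) {A : Set X} (hA : MeasurableSet A) {G : X → ℝ≥0∞} (hG : Measurable[m] G) :
    ∫⁻ x, condExpKernel μ m x A * G x ∂μ = ∫⁻ x in A, G x ∂μ := by
  have hκ : Measurable[m] fun x => condExpKernel μ m x A := measurable_condExpKernel hA
  have h : ((μ.trim hm).withDensity fun x => condExpKernel μ m x A) = (μ.restrict A).trim hm := by
    refine @Measure.ext _ m _ _ fun M hM => ?_
    rw [withDensity_apply _ hM, setLIntegral_trim hm hκ hM,
      setLIntegral_condExpKernel_apply hm hA hM,
      trim_measurableSet_eq hm hM, Measure.restrict_apply (hm _ hM)]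
  rw [← lintegral_trim hm hG, ← h, lintegral_withDensity_eq_lintegral_mul _ hκ hG,
    lintegral_trim hm (hκ.mul hG)]
  rfl

end

section

open ProbabilityTheory

lemma exists_measurableSet_inter_fiber {X : Type*} {m : MeasurableSpace X} {I : Type*} {f : X → I}
    {C : Set X}
    (hC : MeasurableSet[m ⊔ MeasurableSpace.comap f ⊤] C) (i : I) :
    ∃ M, MeasurableSet[m] M ∧ C ∩ f ⁻¹' {i} = M ∩ f ⁻¹' {i} := by
  rw [MeasurableSpace.measurableSet_sup] at hC
  induction C, hC using MeasurableSpace.generateFrom_induction with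
  | hC t ht =>
    rcases ht with ht | ⟨s, -, rfl⟩
    · exact ⟨t, ht, rfl⟩
    · by_cases hi : i ∈ s
      · refine ⟨univ, MeasurableSet.univ, ?_⟩
        ext x
        simp only [mem_inter_iff, mem_preimage, mem_singleton_iff, mem_univ, true_and]
        grind
      · refine ⟨∅, MeasurableSet.empty, ?_⟩
        ext x
        simp only [mem_inter_iff, mem_preimage, mem_singleton_iff, mem_empty_iff_false, false_and]
        grind
  | empty => exact ⟨∅, MeasurableSet.empty, rfl⟩
  | compl t _ ih =>
    obtain ⟨M, hM, h⟩ := ih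
    refine ⟨Mᶜ, hM.compl, ?_⟩
    ext x
    have := Set.ext_iff.1 h x
    simp only [mem_inter_iff, mem_compl_iff] at this ⊢
    tauto
  | iUnion t _ ih =>
    choose M hM h using ih
    refine ⟨⋃ n, M n, MeasurableSet.iUnion hM, ?_⟩
    rw [iUnion_inter, iUnion_inter]
    exact iUnion_congr h

lemma measurable_uncurry_fiber {X : Type*} {m : MeasurableSpace X} {I : Type*} [Countable I]
    (f : X → I) {u : I → X → ℝ≥0∞}
    (hu : ∀ i, Measurable[m] (u i)) :
    Measurable[m ⊔ MeasurableSpace.comap f ⊤] fun x => u (f x) x := by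
  intro s hs
  have h : (fun x => u (f x) x) ⁻¹' s = ⋃ i, (u i ⁻¹' s ∩ f ⁻¹' {i}) := by
    ext x; simp
  rw [h]
  refine MeasurableSet.iUnion fun i => MeasurableSet.inter ?_ ?_
  · exact (le_sup_left : m ≤ m ⊔ MeasurableSpace.comap f ⊤) _ (hu i hs)
  · exact (le_sup_right : MeasurableSpace.comap f ⊤ ≤ m ⊔ MeasurableSpace.comap f ⊤) _
      ⟨{i}, trivial, rfl⟩

variable {X : Type*} {m : MeasurableSpace X} [mX : MeasurableSpace X] {μ : Measure X}

lemma lintegral_fiberwise {I : Type*} [Countable I] {f : X → I} (hf : Measurable[mX, ⊤] f)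
    (C : Set X) (hC : MeasurableSet C) (u : I → X → ℝ≥0∞) :
    ∫⁻ x in C, u (f x) x ∂μ = ∑' i, ∫⁻ x in C ∩ f ⁻¹' {i}, u i x ∂μ := by
  have hfi : ∀ i, MeasurableSet (f ⁻¹' {i}) := fun i => hf trivial
  have hU : C = ⋃ i, C ∩ f ⁻¹' {i} := by ext x; simp
  conv_lhs => rw [hU]
  rw [lintegral_iUnion (fun i => hC.inter (hfi i))]
  · refine tsum_congr fun i => setLIntegral_congr_fun (hC.inter (hfi i)) fun x hx => ?_
    have : f x = i := hx.2
    simp only [this]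
  · intro i j hij
    refine Set.disjoint_left.2 fun x hx hy => hij ?_
    exact (show f x = i from hx.2).symm.trans hy.2

/-- The conditional probability given `Σ` and a countable partition. -/
lemma condProb_sup_comap [StandardBorelSpace X] [IsProbabilityMeasure μ] {I : Type*} [Countable I]
    (hm : m ≤ mX) {f : X → I} (hf : Measurable[mX, ⊤] f) {B : Set X} (hB : MeasurableSet B) :
    (fun x => (condExpKernel μ m x (f ⁻¹' {f x} ∩ B) /
        condExpKernel μ m x (f ⁻¹' {f x})).toReal) =ᵐ[μ]
      μ[B.indicator (fun _ => (1 : ℝ)) | m ⊔ MeasurableSpace.comap f ⊤] := by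
  have hfi : ∀ i, MeasurableSet (f ⁻¹' {i}) := fun i => hf trivial
  have hsup : m ⊔ MeasurableSpace.comap f ⊤ ≤ mX := sup_le hm hf.comap_le
  set u : I → X → ℝ≥0∞ := fun i x =>
    condExpKernel μ m x (f ⁻¹' {i} ∩ B) / condExpKernel μ m x (f ⁻¹' {i}) with hu
  have hum : ∀ i, Measurable[m] (u i) := fun i =>
    (measurable_condExpKernel ((hfi i).inter hB)).div (measurable_condExpKernel (hfi i))
  have hle : ∀ i x, u i x ≤ 1 := fun i x =>
    ENNReal.div_le_of_le_mul (by rw [one_mul]; exact measure_mono inter_subset_left)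
  have hmeas := measurable_uncurry_fiber f hum
  have hmeas' : Measurable fun x => u (f x) x := hmeas.mono hsup le_rfl
  have hui : Integrable (fun x => (u (f x) x).toReal) μ := by
    refine Integrable.of_bound hmeas'.ennreal_toReal.aestronglyMeasurable 1
      (Eventually.of_forall fun x => ?_)
    rw [Real.norm_of_nonneg ENNReal.toReal_nonneg]
    exact ENNReal.toReal_mono ENNReal.one_ne_top (hle _ _)
  refine ae_eq_condExp_of_forall_setIntegral_eq hsup ((integrable_const (1 : ℝ)).indicator hB)
    (fun s _ _ => hui.integrableOn) (fun C hC _ => ?_)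
    (hmeas.ennreal_toReal.stronglyMeasurable.aestronglyMeasurable)
  have hCX : MeasurableSet C := hsup _ hC
  have key : ∫⁻ x in C, u (f x) x ∂μ = μ (C ∩ B) := by
    have h2 : μ (C ∩ B) = ∫⁻ x in C, B.indicator (fun _ => 1) x ∂μ := by
      rw [lintegral_indicator hB, setLIntegral_one, Measure.restrict_apply hB, inter_comm]
    rw [h2, lintegral_fiberwise hf C hCX,
      lintegral_fiberwise hf C hCX (fun _ x => B.indicator (fun _ => 1) x)]
    refine tsum_congr fun i => ?_
    obtain ⟨M, hM, h⟩ := exists_measurableSet_inter_fiber hC i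
    rw [h, inter_comm M, ← Measure.restrict_restrict (hfi i)]
    have e1 : ∫⁻ x in f ⁻¹' {i}, u i x ∂(μ.restrict M) =
        ∫⁻ x in f ⁻¹' {i}, M.indicator (u i) x ∂μ := by
      rw [lintegral_indicator (hm _ hM), Measure.restrict_restrict (hfi i),
        Measure.restrict_restrict (hm _ hM), inter_comm]
    rw [e1, ← lintegral_condExpKernel_mul hm (hfi i) ((hum i).indicator hM),
      Measure.restrict_restrict (hfi i), lintegral_indicator hB, setLIntegral_one,
      Measure.restrict_apply hB]
    have e2 : B ∩ (f ⁻¹' {i} ∩ M) = M ∩ (f ⁻¹' {i} ∩ B) := by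
      ext x; simp only [mem_inter_iff]; tauto
    rw [e2, ← setLIntegral_condExpKernel_apply hm ((hfi i).inter hB) hM,
      ← lintegral_indicator (hm _ hM)]
    refine lintegral_congr fun x => ?_
    by_cases hx : x ∈ M
    · simp only [indicator_of_mem hx, hu]
      by_cases h0 : condExpKernel μ m x (f ⁻¹' {i}) = 0
      · rw [h0, zero_mul, measure_mono_null inter_subset_left h0]
      · exact ENNReal.mul_div_cancel h0 (measure_ne_top _ _)
    · simp [indicator_of_notMem hx]
  rw [integral_toReal hmeas'.aemeasurable
    (Eventually.of_forall fun x => (hle _ _).trans_lt ENNReal.one_lt_top), key,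
    setIntegral_indicator hB, setIntegral_const, smul_eq_mul, mul_one, measureReal_def]

/-- The chain rule for the Shannon entropy of a probability measure. -/
lemma Hpart_prodMk {ν : Measure X} [IsProbabilityMeasure ν] {I J : Type*} [Countable I]
    [Countable J] {f : X → I} {g : X → J} (hf : Measurable[mX, ⊤] f) (hg : Measurable[mX, ⊤] g) :
    Hpart ν (fun x => (f x, g x)) = Hpart ν f +
      ∑' i, ν (f ⁻¹' {i}) * ∑' j, ENNReal.ofReal (Real.negMulLog
        (ν (f ⁻¹' {i} ∩ g ⁻¹' {j}) / ν (f ⁻¹' {i})).toReal) := by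
  have hfi : ∀ i, MeasurableSet (f ⁻¹' {i}) := fun i => hf trivial
  have hgj : ∀ j, MeasurableSet (g ⁻¹' {j}) := fun j => hg trivial
  unfold Hpart
  rw [ENNReal.tsum_prod', ← ENNReal.tsum_add]
  refine tsum_congr fun i => ?_
  have hpre : ∀ j, (fun x => (f x, g x)) ⁻¹' {(i, j)} = f ⁻¹' {i} ∩ g ⁻¹' {j} := by
    intro j; ext x; simp
  simp only [hpre]
  have hsum : ∑' j, ν (f ⁻¹' {i} ∩ g ⁻¹' {j}) = ν (f ⁻¹' {i}) := by
    rw [← measure_iUnion]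
    · congr 1; ext x; simp
    · intro j k hjk
      refine Set.disjoint_left.2 fun x hx hy => hjk ?_
      exact (show g x = j from hx.2).symm.trans hy.2
    · exact fun j => (hfi i).inter (hgj j)
  set p := ν (f ⁻¹' {i}) with hp
  have hp1 : p ≤ 1 := prob_le_one
  have hpt : p ≠ ⊤ := measure_ne_top _ _
  by_cases h0 : p = 0
  · have : ∀ j, ν (f ⁻¹' {i} ∩ g ⁻¹' {j}) = 0 := fun j => measure_mono_null inter_subset_left h0
    simp [h0, this]
  have hpr : 0 < p.toReal := ENNReal.toReal_pos h0 hpt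
  have hpr1 : p.toReal ≤ 1 := ENNReal.toReal_mono ENNReal.one_ne_top hp1
  have hterm : ∀ j, ENNReal.ofReal (Real.negMulLog (ν (f ⁻¹' {i} ∩ g ⁻¹' {j})).toReal) =
      ν (f ⁻¹' {i} ∩ g ⁻¹' {j}) * ENNReal.ofReal (-Real.log p.toReal) +
      p * ENNReal.ofReal (Real.negMulLog (ν (f ⁻¹' {i} ∩ g ⁻¹' {j}) / p).toReal) := by
    intro j
    set q := ν (f ⁻¹' {i} ∩ g ⁻¹' {j})
    have hqp : q ≤ p := measure_mono inter_subset_left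
    have hqt : q ≠ ⊤ := measure_ne_top _ _
    have hq0 : 0 ≤ q.toReal := ENNReal.toReal_nonneg
    have hdiv : q.toReal / p.toReal ≤ 1 :=
      div_le_one_of_le₀ (ENNReal.toReal_mono hpt hqp) hpr.le
    have hlog : 0 ≤ -Real.log p.toReal := by
      linarith [Real.log_nonpos hpr.le hpr1]
    nth_rewrite 2 [← ENNReal.ofReal_toReal hqt]
    nth_rewrite 2 [← ENNReal.ofReal_toReal hpt]
    rw [ENNReal.toReal_div, ← ENNReal.ofReal_mul hq0, ← ENNReal.ofReal_mul hpr.le,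
      ← ENNReal.ofReal_add (mul_nonneg hq0 hlog)
        (mul_nonneg hpr.le (Real.negMulLog_nonneg (div_nonneg hq0 hpr.le) hdiv))]
    congr 1
    have hq : q.toReal = q.toReal / p.toReal * p.toReal := by field_simp
    conv_lhs => rw [hq, Real.negMulLog_mul]
    rw [Real.negMulLog_def]
    beta_reduce
    field_simp
    ring
  rw [tsum_congr hterm, ENNReal.tsum_add, ENNReal.tsum_mul_right, ENNReal.tsum_mul_left, hsum]
  congr 1
  nth_rewrite 1 [← ENNReal.ofReal_toReal hpt]
  rw [← ENNReal.ofReal_mul hpr.le]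
  congr 1
  rw [Real.negMulLog_def]
  ring

lemma measurable_top_prodMk {I J : Type*} [Countable I] [Countable J] {f : X → I} {g : X → J}
    (hf : Measurable[mX, ⊤] f) (hg : Measurable[mX, ⊤] g) :
    Measurable[mX, ⊤] fun x => (f x, g x) := by
  let _ : MeasurableSpace (I × J) := ⊤
  refine measurable_to_countable' fun p => ?_
  have : (fun x => (f x, g x)) ⁻¹' {p} = f ⁻¹' {p.1} ∩ g ⁻¹' {p.2} := by
    ext x; simp [Prod.ext_iff]
  rw [this]
  exact MeasurableSet.inter (hf trivial) (hg trivial)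

/-- The chain rule `H(α ∨ β / Σ) = H(α / Σ) + H(β / α ∨ Σ)`. -/
lemma condEntS_prodMk [StandardBorelSpace X] [IsProbabilityMeasure μ] {I J : Type*} [Countable I]
    [Countable J] (hm : m ≤ mX) {f : X → I} {g : X → J} (hf : Measurable[mX, ⊤] f)
    (hg : Measurable[mX, ⊤] g) :
    condEntS m μ (fun x => (f x, g x)) =
      condEntS m μ f + condEntS (m ⊔ MeasurableSpace.comap f ⊤) μ g := by
  have hfi : ∀ i, MeasurableSet (f ⁻¹' {i}) := fun i => hf trivial
  have hgj : ∀ j, MeasurableSet (g ⁻¹' {j}) := fun j => hg trivial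
  rw [condEntS_eq_lintegral_Hpart hm (measurable_top_prodMk hf hg)]
  simp_rw [Hpart_prodMk hf hg]
  have hmH : Measurable fun x => Hpart (condExpKernel μ m x) f :=
    Measurable.tsum fun i => (Real.continuous_negMulLog.measurable.comp
      ((measurable_condExpKernel (hfi i)).mono hm le_rfl).ennreal_toReal).ennreal_ofReal
  rw [lintegral_add_left hmH, ← condEntS_eq_lintegral_Hpart hm hf]
  congr 1
  set G : I → X → ℝ≥0∞ := fun i x => ∑' j, ENNReal.ofReal (Real.negMulLog
    (condExpKernel μ m x (f ⁻¹' {i} ∩ g ⁻¹' {j}) / condExpKernel μ m x (f ⁻¹' {i})).toReal) with hG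
  have hGm : ∀ i, Measurable[m] (G i) := fun i =>
    @Measurable.tsum _ _ _ m _ _ _ _ _ _ _ _ _ _ _ _ fun j =>
    (Real.continuous_negMulLog.measurable.comp
      ((measurable_condExpKernel ((hfi i).inter (hgj j))).div
        (measurable_condExpKernel (hfi i))).ennreal_toReal).ennreal_ofReal
  have hR : condEntS (m ⊔ MeasurableSpace.comap f ⊤) μ g = ∫⁻ x, G (f x) x ∂μ := by
    refine lintegral_congr_ae ?_
    filter_upwards [ae_all_iff.2 fun j => condProb_sup_comap (μ := μ) hm hf (hgj j)] with x hx
    simp only [hG, hx]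
  rw [hR, ← setLIntegral_univ (fun x => G (f x) x),
    lintegral_fiberwise hf univ MeasurableSet.univ, lintegral_tsum]
  · refine tsum_congr fun i => ?_
    rw [univ_inter, lintegral_condExpKernel_mul hm (hfi i) (hGm i)]
  · exact fun i => (((measurable_condExpKernel (hfi i)).mul (hGm i)).mono hm le_rfl).aemeasurable

end

section

open ProbabilityTheory

variable {X : Type*} {m : MeasurableSpace X} [mX : MeasurableSpace X] {μ : Measure X}

lemma condEntS_comp_of_injective (hm : m ≤ mX) {I J : Type*} [Countable I] [Countable J]
    {v : I → J} (hv : Function.Injective v) (g : X → I) :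
    condEntS m μ (fun x => v (g x)) = condEntS m μ g := by
  rw [condEntS_eq_tsum hm, condEntS_eq_tsum hm, ← hv.tsum_eq]
  · refine tsum_congr fun i => ?_
    have : (fun x => v (g x)) ⁻¹' {v i} = g ⁻¹' {i} := by
      ext x; simp [hv.eq_iff]
    rw [this]
  · intro j hj
    by_contra hj'
    refine hj ?_
    have : (fun x => v (g x)) ⁻¹' {j} = ∅ := by
      ext x
      simp only [mem_preimage, mem_singleton_iff, mem_empty_iff_false, iff_false]
      exact fun h => hj' ⟨g x, h⟩
    simp only [this, indicator_empty]
    have h0 : μ[(fun _ : X => (0 : ℝ)) | m] = 0 := condExp_zero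
    simp [h0]

lemma condEntS_mono_of_factorsThrough [StandardBorelSpace X] [IsProbabilityMeasure μ]
    (hm : m ≤ mX) {I J : Type*} [Countable I] [Countable J] {f : X → I} {g : X → J}
    (hf : Measurable[mX, ⊤] f) (hg : Measurable[mX, ⊤] g) (h : f.FactorsThrough g) :
    condEntS m μ f ≤ condEntS m μ g := by
  have : Nonempty X := nonempty_of_isProbabilityMeasure μ
  have : Nonempty I := ⟨f (Classical.arbitrary X)⟩
  obtain ⟨e, rfl⟩ := (Function.factorsThrough_iff f).1 h
  have hv : Function.Injective fun j => (e j, j) := fun i j hij => (Prod.ext_iff.1 hij).2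
  rw [← condEntS_comp_of_injective hm hv g]
  exact le_self_add.trans_eq (condEntS_prodMk (μ := μ) hm hf hg).symm

lemma condEntS_congr_of_factorsThrough [StandardBorelSpace X] [IsProbabilityMeasure μ]
    (hm : m ≤ mX) {I J : Type*} [Countable I] [Countable J] {f : X → I} {g : X → J}
    (hf : Measurable[mX, ⊤] f) (hg : Measurable[mX, ⊤] g) (h : f.FactorsThrough g)
    (hgf : g.FactorsThrough f) : condEntS m μ f = condEntS m μ g :=
  le_antisymm (condEntS_mono_of_factorsThrough hm hf hg h)
    (condEntS_mono_of_factorsThrough hm hg hf hgf)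

/-- Conditional expectation commutes with a measure-preserving map. -/
lemma condProb_comp_measurePreserving [IsProbabilityMeasure μ] (hm : m ≤ mX) {T : X → X}
    (hT : MeasurePreserving T μ μ) {B : Set X} (hB : MeasurableSet B) :
    (fun x => (μ[B.indicator (fun _ => (1 : ℝ)) | m]) (T x)) =ᵐ[μ]
      μ[(T ⁻¹' B).indicator (fun _ => (1 : ℝ)) | m.comap T] := by
  have hle : m.comap T ≤ mX := (MeasurableSpace.comap_mono hm).trans hT.measurable.comap_le
  have hi : Integrable (μ[B.indicator (fun _ => (1 : ℝ)) | m]) μ := integrable_condExp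
  refine ae_eq_condExp_of_forall_setIntegral_eq hle
    ((integrable_const _).indicator (hT.measurable hB)) ?_ ?_ ?_
  · exact fun s _ _ => (hT.integrable_comp_of_integrable hi).integrableOn
  · rintro s ⟨t, ht, rfl⟩ -
    have key : ∀ F : X → ℝ, Integrable F μ →
        ∫ x in T ⁻¹' t, F (T x) ∂μ = ∫ x in t, F x ∂μ := fun F hF => by
      have h := setIntegral_map (f := F) (hm t ht)
        (hT.map_eq.symm ▸ hF.aestronglyMeasurable) hT.measurable.aemeasurable
      rwa [hT.map_eq, eq_comm] at h
    have hB' : Integrable (B.indicator fun _ => (1 : ℝ)) μ := (integrable_const _).indicator hB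
    rw [key _ hi, setIntegral_condExp hm hB' ht, ← key _ hB']
    rfl
  · exact (stronglyMeasurable_condExp.comp_measurable
      (comap_measurable T)).aestronglyMeasurable

lemma condEntS_comp_measurePreserving [IsProbabilityMeasure μ] (hm : m ≤ mX) {T : X → X}
    (hT : MeasurePreserving T μ μ) {I : Type*} [Countable I] {f : X → I}
    (hf : Measurable[mX, ⊤] f) :
    condEntS (m.comap T) μ (fun x => f (T x)) = condEntS m μ f := by
  have hle : m.comap T ≤ mX := (MeasurableSpace.comap_mono hm).trans hT.measurable.comap_le
  rw [condEntS_eq_tsum hm, condEntS_eq_tsum hle]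
  refine tsum_congr fun i => ?_
  have hB : MeasurableSet (f ⁻¹' {i}) := hf trivial
  have h : Measurable fun x => ENNReal.ofReal (Real.negMulLog
      (μ[(f ⁻¹' {i}).indicator (fun _ => (1 : ℝ)) | m] x)) :=
    (Real.continuous_negMulLog.measurable.comp
    ((stronglyMeasurable_condExp (m := m) (μ := μ)
      (f := (f ⁻¹' {i}).indicator (fun _ => (1 : ℝ)))).mono hm).measurable).ennreal_ofReal
  rw [← hT.lintegral_comp h]
  refine lintegral_congr_ae ?_
  filter_upwards [condProb_comp_measurePreserving hm hT hB] with x hx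
  rw [hx]
  rfl

end

section

open ProbabilityTheory

variable {X : Type*} {m : MeasurableSpace X} [mX : MeasurableSpace X] {μ : Measure X}

lemma condProb_ae_eq_indicator [IsProbabilityMeasure μ] (hm : m ≤ mX) {B B' : Set X}
    (hB' : MeasurableSet[m] B') (h : μ (B ∆ B') = 0) :
    μ[B.indicator (fun _ => (1 : ℝ)) | m] =ᵐ[μ] B.indicator fun _ => (1 : ℝ) := by
  have hBB : B.indicator (fun _ => (1 : ℝ)) =ᵐ[μ] B'.indicator fun _ => (1 : ℝ) :=
    indicator_ae_eq_of_ae_eq_set (measure_symmDiff_eq_zero_iff.1 h)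
  refine (condExp_congr_ae hBB).trans ?_
  have hs : StronglyMeasurable[m] (B'.indicator fun _ => (1 : ℝ)) :=
    stronglyMeasurable_const.indicator hB'
  rw [condExp_of_stronglyMeasurable hm hs ((integrable_const _).indicator (hm _ hB'))]
  exact hBB.symm

lemma tendsto_lintegral_negMulLog_condProb [IsProbabilityMeasure μ] (ℱ : Filtration ℕ mX)
    {B B' : Set X} (hB : MeasurableSet B) (hB' : MeasurableSet[⨆ n, ℱ n] B')
    (h : μ (B ∆ B') = 0) :
    Tendsto (fun n => ∫⁻ x, ENNReal.ofReal
      (Real.negMulLog ((μ[B.indicator (fun _ => (1 : ℝ)) | ℱ n]) x)) ∂μ) atTop (nhds 0) := by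
  have hlim := tendsto_ae_condExp (μ := μ) (ℱ := ℱ) (B.indicator fun _ => (1 : ℝ))
  have hind := condProb_ae_eq_indicator (iSup_le ℱ.le) hB' h
  have h0 : ∫⁻ _, (0 : ℝ≥0∞) ∂μ = 0 := lintegral_zero
  rw [← h0]
  refine tendsto_lintegral_of_dominated_convergence' (fun _ => 1)
    (fun n => (Real.continuous_negMulLog.measurable.comp_aemeasurable
      (aemeasurable_condProb (ℱ.le n) B)).ennreal_ofReal) (fun n => ?_) (by simp) ?_
  · filter_upwards [condProb_mem_Icc (ℱ.le n) hB] with x hx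
    exact ENNReal.ofReal_le_one.2 ((le_abs_self _).trans (abs_negMulLog_le_one hx))
  · filter_upwards [hlim, hind] with x hx hi
    rw [hi] at hx
    have := ENNReal.tendsto_ofReal ((Real.continuous_negMulLog.tendsto _).comp hx)
    have h1 : ENNReal.ofReal (Real.negMulLog (B.indicator (fun _ => (1 : ℝ)) x)) = 0 := by
      by_cases hxB : x ∈ B <;> simp [hxB]
    rwa [h1] at this

/-- Entropy relative to an increasing sequence of σ-algebras that eventually determines the
partition tends to zero. -/
lemma tendsto_condEntS_zero [IsProbabilityMeasure μ] (ℱ : Filtration ℕ mX) {I : Type*}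
    [Countable I] {f : X → I} (hf : Measurable[mX, ⊤] f) (hfin : condEntS (ℱ 0) μ f ≠ ⊤)
    (h : ∀ i, ∃ B', MeasurableSet[⨆ n, ℱ n] B' ∧ μ ((f ⁻¹' {i}) ∆ B') = 0) :
    Tendsto (fun n => condEntS (ℱ n) μ f) atTop (nhds 0) := by
  let _ : MeasurableSpace I := ⊤
  have hfi : ∀ i, MeasurableSet (f ⁻¹' {i}) := fun i => hf trivial
  simp_rw [condEntS_eq_tsum (ℱ.le _), ← lintegral_count]
  rw [condEntS_eq_tsum (ℱ.le _), ← lintegral_count] at hfin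
  rw [← lintegral_zero (μ := Measure.count (α := I))]
  refine tendsto_lintegral_of_dominated_convergence _ (fun n => measurable_from_top)
    (fun n => Eventually.of_forall fun i =>
      lintegral_negMulLog_condProb_anti (ℱ.mono (Nat.zero_le n)) (ℱ.le n) (hfi i)) hfin
    (Eventually.of_forall fun i => ?_)
  obtain ⟨B', hB', hB⟩ := h i
  exact tendsto_lintegral_negMulLog_condProb ℱ (hfi i) hB' hB

end

section

/-- A monotone, submodular, non-negative set function on the finite subsets of a set with an
action of the free group, invariant under that action. -/
structure InvSubmodular (r : ℕ) {J : Type*} [DecidableEq J] [MulAction (FG r) J]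
    (h : Finset J → ℝ) : Prop where
  nonneg : ∀ A, 0 ≤ h A
  mono : ∀ {A B}, A ⊆ B → h A ≤ h B
  submod : ∀ {A B C}, C ⊆ A → C ⊆ B → h (A ∪ B) + h C ≤ h A + h B
  inv : ∀ (g : FG r) A, h (g • A) = h A

/-- The functional `F(A) = (1 - 2r) h(A) + ∑_s h(sA ∪ A)` attached to a set function. -/
noncomputable def setF (r : ℕ) {J : Type*} [DecidableEq J] [MulAction (FG r) J]
    (h : Finset J → ℝ) (A : Finset J) : ℝ :=
  (1 - 2 * (r : ℝ)) * h A + ∑ i : Fin r, h (FreeGroup.of i • A ∪ A)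

/-- The union of `Q` with all its translates by letters. -/
def nbhd (r : ℕ) {J : Type*} [DecidableEq J] [MulAction (FG r) J] (Q : Finset J) : Finset J :=
  Q ∪ Finset.univ.biUnion fun p : Fin r × Bool => letter p • Q

section

variable {r : ℕ} {J : Type*} [DecidableEq J] [MulAction (FG r) J] {h : Finset J → ℝ}

lemma subset_nbhd (Q : Finset J) : Q ⊆ nbhd r Q := Finset.subset_union_left

lemma letter_smul_subset_nbhd (p : Fin r × Bool) (Q : Finset J) : letter p • Q ⊆ nbhd r Q :=
  (Finset.subset_biUnion_of_mem (fun p : Fin r × Bool => letter p • Q)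
    (Finset.mem_univ p)).trans Finset.subset_union_right

lemma letter_flip (p : Fin r × Bool) : letter (p.1, !p.2) = (letter p)⁻¹ := by
  rcases p with ⟨i, b⟩
  cases b <;> simp [letter]

lemma subset_letter_smul_nbhd (p : Fin r × Bool) (Q : Finset J) : Q ⊆ letter p • nbhd r Q := by
  rw [Finset.subset_smul_finset_iff, ← letter_flip]
  exact letter_smul_subset_nbhd _ Q

lemma sum_flip (f : Fin r × Bool → ℝ) : ∑ p : Fin r × Bool, f (p.1, !p.2) = ∑ p, f p :=
  Equiv.sum_comp ((Equiv.refl (Fin r)).prodCongr Equiv.boolNot) f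

namespace InvSubmodular

lemma union_biUnion_le (hh : InvSubmodular r h) {P : Type*} [DecidableEq P] (D : Finset J)
    (R : P → Finset J) (s : Finset P) :
    h (D ∪ s.biUnion R) - h D ≤ ∑ p ∈ s, (h (D ∪ R p) - h D) := by
  induction s using Finset.induction_on with
  | empty => simp
  | insert p s hp ih =>
    rw [Finset.sum_insert hp, Finset.biUnion_insert]
    have h1 := hh.submod (A := D ∪ R p) (B := D ∪ s.biUnion R) (C := D)
      Finset.subset_union_left Finset.subset_union_left
    rw [← Finset.union_union_distrib_left] at h1
    linarith

lemma le_sum_letter (hh : InvSubmodular r h) (D Q : Finset J) :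
    h (D ∪ nbhd r Q) - h (D ∪ Q) + 2 * r * h (D ∪ Q) ≤
      ∑ p : Fin r × Bool, h (D ∪ Q ∪ letter p • Q) := by
  have h1 := hh.union_biUnion_le (D ∪ Q) (fun p : Fin r × Bool => letter p • Q) Finset.univ
  rw [Finset.sum_sub_distrib, Finset.union_assoc D Q (Finset.univ.biUnion _)] at h1
  simp only [Finset.sum_const, Finset.card_univ, Fintype.card_prod, Fintype.card_fin,
    Fintype.card_bool, nsmul_eq_mul, Nat.cast_mul, Nat.cast_ofNat] at h1
  have : h (D ∪ nbhd r Q) =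
    h (D ∪ (Q ∪ Finset.univ.biUnion fun p : Fin r × Bool => letter p • Q)) := rfl
  linarith

lemma setF_eq (hh : InvSubmodular r h) (A : Finset J) :
    setF r h A = (1 - 2 * (r : ℝ)) * h A + (∑ p : Fin r × Bool, h (letter p • A ∪ A)) / 2 := by
  have h1 : ∀ i : Fin r, h ((FreeGroup.of i)⁻¹ • A ∪ A) = h (FreeGroup.of i • A ∪ A) := by
    intro i
    rw [← hh.inv (FreeGroup.of i) ((FreeGroup.of i)⁻¹ • A ∪ A), Finset.smul_finset_union,
      smul_inv_smul, Finset.union_comm]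
  have h2 : ∑ p : Fin r × Bool, h (letter p • A ∪ A) =
      2 * ∑ i : Fin r, h (FreeGroup.of i • A ∪ A) := by
    rw [Fintype.sum_prod_type, Finset.mul_sum]
    refine Finset.sum_congr rfl fun i _ => ?_
    simp [letter, h1, two_mul]
  rw [setF, h2]
  ring

lemma half_nbhd_le_setF (hh : InvSubmodular r h) (Q : Finset J) :
    (1 / 2 - (r : ℝ)) * h Q + h (nbhd r Q) / 2 ≤ setF r h Q := by
  have h1 := hh.le_sum_letter ∅ Q
  simp only [Finset.empty_union] at h1
  rw [hh.setF_eq]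
  simp_rw [Finset.union_comm _ Q]
  linarith

lemma setF_nbhd_le_half (hh : InvSubmodular r h) (Q : Finset J) :
    setF r h (nbhd r Q) ≤ (1 / 2 - (r : ℝ)) * h Q + h (nbhd r Q) / 2 := by
  have h1 := hh.le_sum_letter ∅ Q
  simp only [Finset.empty_union] at h1
  rw [hh.setF_eq]
  have h2 : ∀ p : Fin r × Bool,
      h (letter p • nbhd r Q ∪ nbhd r Q) ≤ 2 * h (nbhd r Q) - h (Q ∪ letter p • Q) := by
    intro p
    have := hh.submod (A := letter p • nbhd r Q) (B := nbhd r Q) (C := Q ∪ letter p • Q)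
      (Finset.union_subset (subset_letter_smul_nbhd p Q)
        (Finset.smul_finset_subset_smul_finset (subset_nbhd Q)))
      (Finset.union_subset (subset_nbhd Q) (letter_smul_subset_nbhd p Q))
    rw [hh.inv] at this
    linarith
  have h3 := Finset.sum_le_sum fun p (_ : p ∈ Finset.univ) => h2 p
  rw [Finset.sum_sub_distrib] at h3
  simp only [Finset.sum_const, Finset.card_univ, Fintype.card_prod, Fintype.card_fin,
    Fintype.card_bool, nsmul_eq_mul, Nat.cast_mul, Nat.cast_ofNat] at h3
  linarith

/-- Enlarging one component of a set to its neighbourhood does not increase `F`. -/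
lemma setF_union_nbhd_le (hh : InvSubmodular r h) (D Q : Finset J) :
    setF r h (D ∪ nbhd r Q) ≤ setF r h (D ∪ Q) := by
  have h1 := hh.le_sum_letter D Q
  rw [hh.setF_eq, hh.setF_eq]
  have h2 : ∀ p : Fin r × Bool,
      h (letter p • (D ∪ nbhd r Q) ∪ (D ∪ nbhd r Q)) ≤ h (letter p • (D ∪ Q) ∪ (D ∪ Q)) +
        2 * h (D ∪ nbhd r Q) - h (D ∪ Q ∪ letter p • Q) -
          h (D ∪ Q ∪ letter (p.1, !p.2) • Q) := by
    intro p
    have hQ := subset_nbhd (r := r) Q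
    have hpQ := letter_smul_subset_nbhd p Q
    have hpP := subset_letter_smul_nbhd p Q
    have hpp : letter p • Q ⊆ letter p • nbhd r Q := Finset.smul_finset_subset_smul_finset hQ
    have e1 := hh.submod (A := D ∪ nbhd r Q) (B := letter p • (D ∪ Q) ∪ (D ∪ Q))
      (C := D ∪ Q ∪ letter p • Q) (by grind) (by rw [Finset.smul_finset_union]; grind)
    have e2 := hh.submod (A := letter p • (D ∪ nbhd r Q))
      (B := D ∪ nbhd r Q ∪ (letter p • (D ∪ Q) ∪ (D ∪ Q)))
      (C := letter p • D ∪ letter p • Q ∪ Q) (by rw [Finset.smul_finset_union]; grind)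
      (by rw [Finset.smul_finset_union]; grind)
    have e3 : letter p • (D ∪ nbhd r Q) ∪ (D ∪ nbhd r Q ∪ (letter p • (D ∪ Q) ∪ (D ∪ Q))) =
        letter p • (D ∪ nbhd r Q) ∪ (D ∪ nbhd r Q) := by
      simp only [Finset.smul_finset_union]
      grind
    have e4 : h (letter p • D ∪ letter p • Q ∪ Q) =
        h (D ∪ Q ∪ letter (p.1, !p.2) • Q) := by
      rw [← hh.inv (letter p)⁻¹, Finset.smul_finset_union, Finset.smul_finset_union,
        inv_smul_smul, inv_smul_smul, letter_flip]
    rw [e3, hh.inv, e4] at e2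
    linarith
  have h3 := Finset.sum_le_sum fun p (_ : p ∈ Finset.univ) => h2 p
  simp only [Finset.sum_sub_distrib, Finset.sum_add_distrib] at h3
  rw [sum_flip fun p => h (D ∪ Q ∪ letter p • Q)] at h3
  simp only [Finset.sum_const, Finset.card_univ, Fintype.card_prod, Fintype.card_fin,
    Fintype.card_bool, nsmul_eq_mul, Nat.cast_mul, Nat.cast_ofNat] at h3
  linarith

lemma setF_nbhd_le (hh : InvSubmodular r h) (Q : Finset J) : setF r h (nbhd r Q) ≤ setF r h Q := by
  simpa using hh.setF_union_nbhd_le ∅ Q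

lemma setF_le_setF_union (hh : InvSubmodular r h) (D Q : Finset J) :
    setF r h Q ≤ setF r h (D ∪ Q) + (2 * r - 1) * (h (D ∪ Q) - h Q) := by
  have : ∑ i : Fin r, h (FreeGroup.of i • Q ∪ Q) ≤
      ∑ i : Fin r, h (FreeGroup.of i • (D ∪ Q) ∪ (D ∪ Q)) :=
    Finset.sum_le_sum fun i _ => hh.mono (Finset.union_subset_union
      (Finset.smul_finset_subset_smul_finset Finset.subset_union_right) Finset.subset_union_right)
  unfold setF
  linarith

lemma setF_union_le (hh : InvSubmodular r h) (D Q : Finset J) :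
    setF r h (D ∪ Q) ≤ setF r h D + h Q := by
  have h0 := hh.submod (A := D) (B := Q) (C := ∅) (by simp) (by simp)
  have h1 : ∀ i : Fin r, h (FreeGroup.of i • (D ∪ Q) ∪ (D ∪ Q)) ≤
      h (FreeGroup.of i • D ∪ D) + 2 * (h (D ∪ Q) - h D) := by
    intro i
    have e1 := hh.submod (A := D ∪ Q) (B := FreeGroup.of i • D ∪ D) (C := D)
      (by grind) (by grind)
    have e2 := hh.submod (A := FreeGroup.of i • (D ∪ Q))
      (B := D ∪ Q ∪ (FreeGroup.of i • D ∪ D)) (C := FreeGroup.of i • D)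
      (by rw [Finset.smul_finset_union]; grind) (by grind)
    have e3 : FreeGroup.of i • (D ∪ Q) ∪ (D ∪ Q ∪ (FreeGroup.of i • D ∪ D)) =
        FreeGroup.of i • (D ∪ Q) ∪ (D ∪ Q) := by
      simp only [Finset.smul_finset_union]
      grind
    rw [e3, hh.inv, hh.inv] at e2
    linarith
  have h2 := Finset.sum_le_sum fun p (_ : p ∈ Finset.univ) => h1 p
  simp only [Finset.sum_add_distrib, Finset.sum_const, Finset.card_univ, Fintype.card_fin,
    nsmul_eq_mul] at h2
  have h3 := hh.nonneg ∅
  unfold setF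
  linarith

end InvSubmodular

end

end

section

open ProbabilityTheory

lemma measurable_top_pi {X : Type*} {m : MeasurableSpace X} {A I : Type*} [Finite A] [Countable I]
    {o : A → X → I} (ho : ∀ j, Measurable[m, ⊤] (o j)) :
    Measurable[m, ⊤] fun x (j : A) => o j x := by
  let _ : MeasurableSpace (A → I) := ⊤
  refine measurable_to_countable' fun v => ?_
  have : (fun x (j : A) => o j x) ⁻¹' {v} = ⋂ j, o j ⁻¹' {v j} := by
    ext x
    simp [funext_iff]
  rw [this]
  exact MeasurableSet.iInter fun j => ho j trivial

lemma comap_pi_top {X : Type*} {A I : Type*} [Finite A] [Countable I] (o : A → X → I) :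
    MeasurableSpace.comap (fun x (j : A) => o j x) ⊤ = ⨆ j, MeasurableSpace.comap (o j) ⊤ := by
  refine le_antisymm ?_ (iSup_le fun j => ?_)
  · rw [← measurable_iff_comap_le]
    exact measurable_top_pi fun j => measurable_iff_comap_le.2
      (le_iSup (fun j => MeasurableSpace.comap (o j) ⊤) j)
  · have : o j = (fun v : A → I => v j) ∘ fun x (j : A) => o j x := rfl
    rw [this, ← MeasurableSpace.comap_comp]
    exact MeasurableSpace.comap_mono le_top

variable {X : Type*} {m : MeasurableSpace X} [mX : MeasurableSpace X] {μ : Measure X}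

lemma InvariantSA.comap_eq {G : Type*} [Group G] {T : BorelAction G X} (hm : InvariantSA m T)
    (g : G) : m.comap (T.act g) = m := by
  refine le_antisymm ?_ fun B hB => ?_
  · rintro _ ⟨B, hB, rfl⟩
    exact hm.2 g B hB
  · refine ⟨T.act g⁻¹ ⁻¹' B, hm.2 _ B hB, ?_⟩
    ext x
    simp only [mem_preimage]
    rw [← T.act_mul, inv_mul_cancel, T.act_one]

lemma condEntS_of_subsingleton [IsProbabilityMeasure μ] {I : Type*} [Subsingleton I]
    (hm : m ≤ mX) (f : X → I) : condEntS m μ f = 0 := by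
  rw [condEntS_eq_tsum hm, ENNReal.tsum_eq_zero]
  intro i
  have h1 : f ⁻¹' {i} = univ := eq_univ_of_forall fun x => Subsingleton.elim _ _
  have h2 : μ[(fun _ : X => (1 : ℝ)) | m] = fun _ => 1 := condExp_const hm 1
  simp [h1, h2]

lemma sup_iSup_comap_le {J I : Type*} {o : J → X → I} (hm : m ≤ mX)
    (ho : ∀ j, Measurable[mX, ⊤] (o j)) (p : J → Prop) :
    m ⊔ ⨆ (j) (_ : p j), MeasurableSpace.comap (o j) ⊤ ≤ mX :=
  sup_le hm (iSup₂_le fun j _ => (ho j).comap_le)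

lemma condEntS_tuple_singleton [StandardBorelSpace X] [IsProbabilityMeasure μ] {J I : Type*}
    [Countable I] {o : J → X → I} (hm : m ≤ mX) (ho : ∀ j, Measurable[mX, ⊤] (o j)) (j : J) :
    condEntS m μ (fun x (i : ({j} : Finset J)) => o i x) = condEntS m μ (o j) := by
  refine condEntS_congr_of_factorsThrough hm (measurable_top_pi fun i : ({j} : Finset J) => ho i)
    (ho j) ?_ ?_ <;> intro x y hxy <;> simpa [funext_iff] using hxy

/-- The joint conditional entropy of a finite family of partitions. -/
noncomputable def jointEnt {X J I : Type*} (m : MeasurableSpace X) [mX : MeasurableSpace X]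
    [Countable I] (μ : Measure X) (o : J → X → I) (A : Finset J) : ℝ :=
  (condEntS m μ fun x (j : A) => o j x).toReal

section

variable [StandardBorelSpace X] [IsProbabilityMeasure μ] {J I : Type*} [DecidableEq J]
  [Countable I] {o : J → X → I}

lemma condEntS_tuple_union (hm : m ≤ mX) (ho : ∀ j, Measurable[mX, ⊤] (o j)) (A B : Finset J) :
    condEntS m μ (fun x (j : (A ∪ B : Finset J)) => o j x) =
      condEntS m μ (fun x (j : A) => o j x) +
        condEntS (m ⊔ ⨆ j ∈ A, MeasurableSpace.comap (o j) ⊤) μ (fun x (j : B) => o j x) := by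
  have hA := measurable_top_pi fun j : A => ho j
  have hB := measurable_top_pi fun j : B => ho j
  have hAB := measurable_top_pi fun j : (A ∪ B : Finset J) => ho j
  rw [iSup_subtype', ← comap_pi_top fun j : A => o j, ← condEntS_prodMk hm hA hB]
  refine condEntS_congr_of_factorsThrough hm hAB (measurable_top_prodMk hA hB) ?_ ?_
  · intro x y hxy
    simp only [Prod.mk.injEq, funext_iff, Subtype.forall] at hxy ⊢
    intro j hj
    rcases Finset.mem_union.1 hj with hj | hj
    exacts [hxy.1 j hj, hxy.2 j hj]
  · intro x y hxy
    simp only [Prod.mk.injEq, funext_iff, Subtype.forall] at hxy ⊢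
    exact ⟨fun j hj => hxy j (Finset.mem_union_left _ hj),
      fun j hj => hxy j (Finset.mem_union_right _ hj)⟩

lemma condEntS_tuple_mono (hm : m ≤ mX) (ho : ∀ j, Measurable[mX, ⊤] (o j)) {A B : Finset J}
    (hAB : A ⊆ B) :
    condEntS m μ (fun x (j : A) => o j x) ≤ condEntS m μ (fun x (j : B) => o j x) := by
  rw [← Finset.union_eq_right.2 hAB, condEntS_tuple_union hm ho]
  exact le_self_add

lemma condEntS_tuple_ne_top (hm : m ≤ mX) (ho : ∀ j, Measurable[mX, ⊤] (o j))
    (hfin : ∀ j, condEntS m μ (o j) ≠ ⊤) (A : Finset J) :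
    condEntS m μ (fun x (j : A) => o j x) ≠ ⊤ := by
  induction A using Finset.induction_on with
  | empty =>
    rw [condEntS_of_subsingleton hm]
    exact ENNReal.zero_ne_top
  | insert j A hj ih =>
    rw [Finset.insert_eq, condEntS_tuple_union hm ho, condEntS_tuple_singleton hm ho]
    refine ENNReal.add_ne_top.2 ⟨hfin j, ne_top_of_le_ne_top ih ?_⟩
    exact condEntS_anti le_sup_left (sup_iSup_comap_le hm ho (· ∈ _))
      (measurable_top_pi fun i : A => ho i)

lemma jointEnt_union (hm : m ≤ mX) (ho : ∀ j, Measurable[mX, ⊤] (o j))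
    (hfin : ∀ j, condEntS m μ (o j) ≠ ⊤) (A B : Finset J) :
    jointEnt m μ o (A ∪ B) = jointEnt m μ o A +
      (condEntS (m ⊔ ⨆ j ∈ A, MeasurableSpace.comap (o j) ⊤) μ
        (fun x (j : B) => o j x)).toReal := by
  rw [jointEnt, condEntS_tuple_union hm ho, ENNReal.toReal_add, jointEnt]
  · exact condEntS_tuple_ne_top hm ho hfin A
  · exact ne_top_of_le_ne_top (condEntS_tuple_ne_top hm ho hfin B)
      (condEntS_anti le_sup_left (sup_iSup_comap_le hm ho (· ∈ _))
        (measurable_top_pi fun i : B => ho i))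

lemma invSubmodular_jointEnt {r : ℕ} [MulAction (FG r) J] {T : BorelAction (FG r) X}
    (hT : T.Preserves μ) (hm : InvariantSA m T) (ho : ∀ j, Measurable[mX, ⊤] (o j))
    (hfin : ∀ j, condEntS m μ (o j) ≠ ⊤)
    (hact : ∀ (g : FG r) j x, o (g • j) x = o j (T.act g⁻¹ x)) :
    InvSubmodular r (jointEnt m μ o) where
  nonneg A := ENNReal.toReal_nonneg
  mono {A B} hAB := ENNReal.toReal_mono (condEntS_tuple_ne_top hm.1 ho hfin B)
    (condEntS_tuple_mono hm.1 ho hAB)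
  submod {A B C} hA hB := by
    have h1 := jointEnt_union (μ := μ) hm.1 ho hfin A B
    have h2 := jointEnt_union (μ := μ) hm.1 ho hfin C B
    rw [Finset.union_eq_right.2 hB] at h2
    have h3 : condEntS (m ⊔ ⨆ j ∈ A, MeasurableSpace.comap (o j) ⊤) μ (fun x (j : B) => o j x) ≤
        condEntS (m ⊔ ⨆ j ∈ C, MeasurableSpace.comap (o j) ⊤) μ (fun x (j : B) => o j x) :=
      condEntS_anti (sup_le_sup_left (biSup_mono fun j hj => hA hj) _)
        (sup_iSup_comap_le hm.1 ho (· ∈ _)) (measurable_top_pi fun i : B => ho i)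
    have h4 := ENNReal.toReal_mono (ne_top_of_le_ne_top (condEntS_tuple_ne_top hm.1 ho hfin B)
      (condEntS_anti le_sup_left (sup_iSup_comap_le hm.1 ho (· ∈ _))
        (measurable_top_pi fun i : B => ho i))) h3
    linarith
  inv g A := by
    have hA := measurable_top_pi fun j : A => ho j
    unfold jointEnt
    congr 1
    rw [← condEntS_comp_measurePreserving hm.1 (hT g⁻¹) hA, hm.comap_eq]
    refine condEntS_congr_of_factorsThrough hm.1
      (measurable_top_pi fun j : (g • A : Finset J) => ho j)
      (hA.comp (T.measurable_act g⁻¹)) ?_ ?_ <;> intro x y hxy <;>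
      simpa [funext_iff, Finset.mem_smul_finset, hact] using hxy

end

end

section

section

variable {r : ℕ}

/-- The ball of radius `n` as a finset. -/
noncomputable def ballF (r n : ℕ) : Finset (FG r) := (Set.toFinite (ball r n)).toFinset

@[simp] lemma mem_ballF {n : ℕ} {g : FG r} : g ∈ ballF r n ↔ wlen g ≤ n := by
  simp [ballF, ball]

lemma letter_eq_mk (p : Fin r × Bool) : letter p = FreeGroup.mk [p] := by
  rcases p with ⟨i, b⟩
  cases b <;> rfl

lemma wlen_mul_le (g h : FG r) : wlen (g * h) ≤ wlen g + wlen h := FreeGroup.norm_mul_le g h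

lemma wlen_letter_mul_le (p : Fin r × Bool) (g : FG r) : wlen (letter p * g) ≤ wlen g + 1 := by
  have h1 : wlen (letter p) ≤ 1 := letter_eq_mk p ▸ FreeGroup.norm_mk_le
  have h2 := wlen_mul_le (letter p) g
  lia

lemma exists_mul_of_wlen_le {g : FG r} {k n : ℕ} (hg : wlen g ≤ k + n) :
    ∃ a b : FG r, wlen a ≤ k ∧ wlen b ≤ n ∧ a * b = g := by
  refine ⟨FreeGroup.mk (g.toWord.take k), FreeGroup.mk (g.toWord.drop k),
    FreeGroup.norm_mk_le.trans (by simp), FreeGroup.norm_mk_le.trans ?_, ?_⟩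
  · rw [List.length_drop]
    unfold wlen at hg
    lia
  · rw [FreeGroup.mul_mk, List.take_append_drop, FreeGroup.mk_toWord]

/-- A nontrivial element with its first letter removed. -/
lemma toWord_eq_cons {g : FG r} (hg : 1 ≤ wlen g) :
    ∃ p : Fin r × Bool, firstLetter g = letter p ∧
      g.toWord = p :: ((firstLetter g)⁻¹ * g).toWord := by
  cases hw : g.toWord with
  | nil => simp [wlen, hw] at hg
  | cons p w =>
    refine ⟨p, by simp [firstLetter, hw], ?_⟩
    have hg' : g = letter p * FreeGroup.mk w := by
      rw [letter_eq_mk, FreeGroup.mul_mk, ← FreeGroup.mk_toWord (x := g), hw]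
      rfl
    have hf : firstLetter g = letter p := by simp [firstLetter, hw]
    have hred : FreeGroup.IsReduced (p :: w) := hw ▸ FreeGroup.isReduced_toWord
    have hredw : FreeGroup.IsReduced w := List.IsChain.tail hred
    rw [hf]
    conv_rhs => rw [hg', inv_mul_cancel_left, FreeGroup.toWord_mk, hredw.reduce_eq]

lemma wlen_firstLetter_inv_mul {g : FG r} (hg : 1 ≤ wlen g) :
    wlen ((firstLetter g)⁻¹ * g) + 1 = wlen g := by
  obtain ⟨p, -, hp⟩ := toWord_eq_cons hg
  simp [wlen, hp]

lemma ballF_succ (n : ℕ) : ballF r (n + 1) = nbhd r (ballF r n) := by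
  ext g
  simp only [nbhd, mem_ballF, Finset.mem_union, Finset.mem_biUnion, Finset.mem_univ, true_and,
    Finset.mem_smul_finset, smul_eq_mul]
  constructor
  · intro hg
    by_cases h : wlen g ≤ n
    · exact Or.inl h
    · have h1 : 1 ≤ wlen g := by lia
      obtain ⟨p, hp, -⟩ := toWord_eq_cons h1
      have := wlen_firstLetter_inv_mul h1
      exact Or.inr ⟨p, (firstLetter g)⁻¹ * g, by lia, by rw [← hp, mul_inv_cancel_left]⟩
  · rintro (h | ⟨p, g', h, rfl⟩)
    · lia
    · have := wlen_letter_mul_le p g'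
      lia

lemma toWord_letter_mul {p : Fin r × Bool} {g : FG r} (h : wlen (letter p * g) = wlen g + 1) :
    (letter p * g).toWord = p :: g.toWord := by
  have h1 : (letter p * g).toWord.Sublist ((letter p).toWord ++ g.toWord) :=
    FreeGroup.toWord_mul_sublist _ _
  rw [letter_eq_mk, FreeGroup.toWord_mk, FreeGroup.reduce_singleton] at h1
  rw [letter_eq_mk] at h ⊢
  exact h1.eq_of_length (by simpa [wlen] using h)

/-- The elements of length `k`. -/
noncomputable def sphereF (r k : ℕ) : Finset (FG r) := (ballF r k).filter fun g => wlen g = k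

@[simp] lemma mem_sphereF {k : ℕ} {g : FG r} : g ∈ sphereF r k ↔ wlen g = k := by
  simp +contextual [sphereF]

/-- Each element of positive length has at most `2r - 1` successors. -/
lemma card_filter_sphereF_le {k : ℕ} {t : FG r} (hk : 1 ≤ wlen t) :
    ((sphereF r k).filter fun g => 1 ≤ wlen g ∧ (firstLetter g)⁻¹ * g = t).card + 1 ≤ 2 * r := by
  obtain ⟨q, -, hq⟩ := toWord_eq_cons hk
  have hcard : (Finset.univ.erase (q.1, !q.2)).card + 1 = 2 * r := by
    rw [Finset.card_erase_add_one (Finset.mem_univ _)]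
    simp [mul_comm]
  rw [← hcard]
  refine Nat.add_le_add_right (Finset.card_le_card_of_injOn
    (fun g => g.toWord.head?.getD q) ?_ ?_) 1
  · intro g hg
    simp only [Finset.coe_filter, mem_sphereF, Set.mem_ofPred_eq] at hg
    obtain ⟨-, hg1, rfl⟩ := hg
    obtain ⟨p, -, hp⟩ := toWord_eq_cons hg1
    have hred : FreeGroup.IsReduced g.toWord := FreeGroup.isReduced_toWord
    rw [hp, hq] at hred
    have h1 := (List.isChain_cons_cons.1 hred).1
    simp only [hp, List.head?_cons, Option.getD_some, Finset.coe_erase, Finset.coe_univ,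
      Set.mem_sdiff,
      mem_univ, mem_singleton_iff, true_and]
    rintro rfl
    simp at h1
  · intro g hg g' hg' h
    simp only [Finset.coe_filter, mem_sphereF, Set.mem_ofPred_eq] at hg hg'
    obtain ⟨p, -, hp⟩ := toWord_eq_cons hg.2.1
    obtain ⟨p', -, hp'⟩ := toWord_eq_cons hg'.2.1
    rw [hg.2.2] at hp
    rw [hg'.2.2] at hp'
    simp only [hp, hp', List.head?_cons, Option.getD_some] at h
    exact FreeGroup.toWord_injective (by rw [hp, hp', h])

/-- A linearly ordered key inducing the order `wlt`. -/
def wkey (ord : Fin r × Bool → ℕ) (g : FG r) : ℕ ×ₗ List ℕ :=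
  toLex (wlen g, g.toWord.map ord)

lemma lex_iff_map_lt {ord : Fin r × Bool → ℕ} (hord : Function.Injective ord)
    (l l' : List (Fin r × Bool)) :
    List.Lex (fun p q => ord p < ord q) l l' ↔ l.map ord < l'.map ord := by
  induction l generalizing l' with
  | nil => cases l' <;> simp
  | cons p l ih =>
    cases l' with
    | nil => simp
    | cons q l' =>
      simp only [List.map_cons, List.cons_lt_cons_iff, ← ih, hord.eq_iff]
      constructor
      · rintro (_ | h | h)
        exacts [Or.inl h, Or.inr ⟨rfl, h⟩]
      · rintro (h | ⟨rfl, h⟩)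
        exacts [List.Lex.rel h, List.Lex.cons h]

lemma wlt_iff_wkey_lt {ord : Fin r × Bool → ℕ} (hord : Function.Injective ord) (g h : FG r) :
    wlt ord g h ↔ wkey ord g < wkey ord h := by
  rw [wlt, wkey, wkey, Prod.Lex.toLex_lt_toLex, lex_iff_map_lt hord]

lemma wkey_injective {ord : Fin r × Bool → ℕ} (hord : Function.Injective ord) :
    Function.Injective (wkey ord) := fun _ _ hgh =>
  FreeGroup.toWord_injective
    (List.map_injective_iff.2 hord (Prod.ext_iff.1 (toLex.injective hgh)).2)

lemma Pre_subset_ball (ord : Fin r × Bool → ℕ) (g : FG r) : Pre ord g ⊆ ball r (wlen g) := by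
  rintro h (h1 | h1)
  exacts [h1.le, h1.1.le]

lemma firstLetter_mul_mem_Pre {ord : Fin r × Bool → ℕ} {g h : FG r} (hg : 1 ≤ wlen g)
    (hh : h ∈ Pre ord ((firstLetter g)⁻¹ * g)) : firstLetter g * h ∈ Pre ord g := by
  obtain ⟨p, hp, hw⟩ := toWord_eq_cons hg
  have hl := wlen_firstLetter_inv_mul hg
  have h1 := wlen_letter_mul_le p h
  rw [hp] at hh hl hw ⊢
  rcases hh with hh | ⟨hh, hlex⟩
  · exact Or.inl (by lia)
  · by_cases h2 : wlen (letter p * h) < wlen g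
    · exact Or.inl h2
    · refine Or.inr ⟨by lia, ?_⟩
      rw [toWord_letter_mul (by lia), hw]
      exact List.Lex.cons hlex

end

end

section

variable {X : Type*} {m : MeasurableSpace X} [mX : MeasurableSpace X] {μ : Measure X}

section

variable {r : ℕ} {T : BorelAction (FG r) X}

lemma measurable_top_tr {I : Type*} {a : X → I} (ha : Measurable[mX, ⊤] a) (g : FG r) :
    Measurable[mX, ⊤] (T.tr g a) := ha.comp (T.measurable_act _)

lemma tr_smul {I : Type*} (a : X → I) (g h : FG r) (x : X) :
    T.tr (g * h) a x = T.tr h a (T.act g⁻¹ x) := by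
  simp only [BorelAction.tr, mul_inv_rev, T.act_mul]

lemma measurable_top_joinF {I : Type*} [Countable I] {a : X → I} (ha : Measurable[mX, ⊤] a)
    (n : ℕ) : Measurable[mX, ⊤] (T.joinF (ball r n) a) :=
  measurable_top_pi fun g : ball r n => measurable_top_tr ha g.1

lemma joinF_ball_eq_iff {I : Type*} (a : X → I) (n : ℕ) (x y : X) :
    T.joinF (ball r n) a x = T.joinF (ball r n) a y ↔
      ∀ g ∈ ballF r n, T.tr g a x = T.tr g a y := by
  simp [funext_iff, BorelAction.joinF, BorelAction.tr, ball]

lemma condEntS_tr [IsProbabilityMeasure μ] (hT : T.Preserves μ) (hm : InvariantSA m T)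
    {I : Type*} [Countable I] {a : X → I} (ha : Measurable[mX, ⊤] a) (g : FG r) :
    condEntS m μ (T.tr g a) = condEntS m μ a := by
  conv_lhs => rw [← hm.comap_eq g⁻¹]
  exact condEntS_comp_measurePreserving hm.1 (hT g⁻¹) ha

variable [StandardBorelSpace X] [IsProbabilityMeasure μ]

/-- If a partition is the join of a finite family, then its `F`-functional is computed by the joint
entropies of the family. -/
lemma FFrel_eq_setF {J I K : Type*} [DecidableEq J] [Countable I] [Countable K]
    [MulAction (FG r) J] {o : J → X → I} (hm : m ≤ mX) (ho : ∀ j, Measurable[mX, ⊤] (o j))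
    (hact : ∀ (g : FG r) j x, o (g • j) x = o j (T.act g⁻¹ x)) {b : X → K}
    (hb : Measurable[mX, ⊤] b) {A : Finset J}
    (hA : ∀ x y, b x = b y ↔ ∀ j ∈ A, o j x = o j y) :
    FFrel m μ T b = setF r (jointEnt m μ o) A := by
  have hoA : ∀ A : Finset J, Measurable[mX, ⊤] fun x (j : A) => o j x :=
    fun A => measurable_top_pi fun j : A => ho j
  unfold FFrel setF
  refine congrArg₂ (· + ·) (congrArg _ ?_) (Finset.sum_congr rfl fun i _ => ?_)
  · unfold jointEnt
    congr 1
    refine condEntS_congr_of_factorsThrough hm hb (hoA A) ?_ ?_ <;> intro x y hxy <;>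
      simpa [funext_iff, hA] using hxy
  · unfold jointEnt
    congr 1
    refine condEntS_congr_of_factorsThrough hm
      (measurable_top_prodMk (hb.comp (T.measurable_act _)) hb) (hoA _) ?_ ?_ <;>
      intro x y hxy
    · simp only [Prod.mk.injEq, BorelAction.tr, hA]
      simp only [funext_iff, Subtype.forall] at hxy
      refine ⟨fun j hj => ?_, fun j hj => hxy j (Finset.mem_union_right _ hj)⟩
      simpa only [hact] using
        hxy _ (Finset.mem_union_left _ (Finset.smul_mem_smul_finset hj))
    · simp only [Prod.mk.injEq, BorelAction.tr, hA] at hxy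
      simp only [funext_iff, Subtype.forall]
      intro j hj
      rcases Finset.mem_union.1 hj with hj | hj
      · obtain ⟨j, hjA, rfl⟩ := Finset.mem_smul_finset.1 hj
        simpa only [hact] using hxy.1 j hjA
      · exact hxy.2 j hj

lemma condEntS_joinF_ne_top (hT : T.Preserves μ) (hm : InvariantSA m T) {I : Type*} [Countable I]
    {a : X → I} (ha : Measurable[mX, ⊤] a) (hfin : condEntS m μ a ≠ ⊤) (n : ℕ) :
    condEntS m μ (T.joinF (ball r n) a) ≠ ⊤ := by
  have h := condEntS_tuple_ne_top (μ := μ) hm.1 (fun g => measurable_top_tr (T := T) ha g)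
    (fun g => by rwa [condEntS_tr hT hm ha]) (ballF r n)
  refine ne_top_of_le_ne_top h (condEntS_mono_of_factorsThrough hm.1 (measurable_top_joinF ha n)
    (measurable_top_pi fun g : ballF r n => measurable_top_tr ha g.1) fun x y hxy => ?_)
  rw [joinF_ball_eq_iff]
  simpa only [funext_iff, Subtype.forall] using hxy

lemma invSubmodular_tr (hT : T.Preserves μ) (hm : InvariantSA m T) {I : Type*} [Countable I]
    {a : X → I} (ha : Measurable[mX, ⊤] a) (hfin : condEntS m μ a ≠ ⊤) :
    InvSubmodular r (jointEnt m μ fun g : FG r => T.tr g a) :=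
  invSubmodular_jointEnt hT hm (fun g => measurable_top_tr ha g)
    (fun g => by rwa [condEntS_tr hT hm ha]) fun g h x => tr_smul a g h x

lemma fSeqRel_add (hm : InvariantSA m T) {a : X → ℕ} (ha : Measurable[mX, ⊤] a) (n k : ℕ) :
    fSeqRel m μ T a (n + k) =
      setF r (jointEnt m μ fun g : FG r => T.tr g (T.joinF (ball r n) a)) (ballF r k) := by
  refine FFrel_eq_setF hm.1 (fun g => measurable_top_tr (measurable_top_joinF ha n) g)
    (fun g h x => tr_smul _ g h x) (measurable_top_joinF ha _) fun x y => ?_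
  rw [joinF_ball_eq_iff]
  simp only [BorelAction.tr, joinF_ball_eq_iff, mem_ballF]
  constructor
  · intro h g hg g' hg'
    simp only [← T.act_mul, ← mul_inv_rev]
    exact h _ ((wlen_mul_le g g').trans (by lia))
  · intro h g hg
    obtain ⟨u, v, hu, hv, rfl⟩ := exists_mul_of_wlen_le (k := k) (n := n) (g := g) (by lia)
    rw [mul_inv_rev, T.act_mul, T.act_mul]
    exact h u hu v hv

lemma fSeqRel_antitone (hT : T.Preserves μ) (hm : InvariantSA m T) {a : X → ℕ}
    (ha : Measurable[mX, ⊤] a) (hfin : condEntS m μ a ≠ ⊤) : Antitone (fSeqRel m μ T a) := by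
  refine antitone_nat_of_succ_le fun n => ?_
  have hh := invSubmodular_tr hT hm (measurable_top_joinF (T := T) ha n)
    (condEntS_joinF_ne_top hT hm ha hfin n)
  have h1 := hh.setF_nbhd_le (ballF r 0)
  rwa [← ballF_succ, ← fSeqRel_add hm ha, ← fSeqRel_add hm ha] at h1

end

end

section

variable {X : Type*} {m : MeasurableSpace X} [mX : MeasurableSpace X] {μ : Measure X}

/-- The entropy of a translate given all preceding translates. -/
noncomputable def preEnt {r : ℕ} {X I : Type*} (m : MeasurableSpace X) [mX : MeasurableSpace X]
    [Countable I] (μ : Measure X) (T : BorelAction (FG r) X) (ord : Fin r × Bool → ℕ) (b : X → I)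
    (g : FG r) : ℝ :=
  (condEntS (m ⊔ T.partSA (Pre ord g) b) μ (T.tr g b)).toReal

section

variable {r : ℕ} {T : BorelAction (FG r) X} {I : Type*} {b : X → I}
  {ord : Fin r × Bool → ℕ}

lemma partSA_le (hb : Measurable[mX, ⊤] b) (A : Set (FG r)) : T.partSA A b ≤ mX :=
  iSup₂_le fun g _ => (measurable_top_tr hb g).comap_le

lemma comap_act_partSA (A : Set (FG r)) (s : FG r) (b : X → I) :
    (T.partSA A b).comap (T.act s⁻¹) = ⨆ g ∈ A, MeasurableSpace.comap (T.tr (s * g) b) ⊤ := by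
  simp only [BorelAction.partSA, MeasurableSpace.comap_iSup, MeasurableSpace.comap_comp]
  refine iSup_congr fun g => iSup_congr fun _ => ?_
  exact congrArg (MeasurableSpace.comap · ⊤) (funext fun x => (tr_smul b s g x).symm)

variable [Countable I]

lemma preEnt_nonneg (g : FG r) : 0 ≤ preEnt m μ T ord b g := ENNReal.toReal_nonneg

lemma sum_preEnt_tail_le {k : ℕ} (hk : 1 ≤ k) :
    ∑ g ∈ sphereF r (k + 1), preEnt m μ T ord b ((firstLetter g)⁻¹ * g) ≤
      (2 * r - 1) * ∑ t ∈ sphereF r k, preEnt m μ T ord b t := by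
  have hmaps : ∀ g ∈ sphereF r (k + 1), (firstLetter g)⁻¹ * g ∈ sphereF r k := by
    intro g hg
    rw [mem_sphereF] at hg ⊢
    have := wlen_firstLetter_inv_mul (g := g) (by lia)
    lia
  rw [← Finset.sum_fiberwise_of_maps_to hmaps, Finset.mul_sum]
  refine Finset.sum_le_sum fun t ht => ?_
  rw [mem_sphereF] at ht
  have hcard := card_filter_sphereF_le (k := k + 1) (t := t) (by lia)
  have hset : ((sphereF r (k + 1)).filter fun g => 1 ≤ wlen g ∧ (firstLetter g)⁻¹ * g = t) =
      (sphereF r (k + 1)).filter fun g => (firstLetter g)⁻¹ * g = t := by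
    refine Finset.filter_congr fun g hg => ?_
    rw [mem_sphereF] at hg
    simp [hg]
  rw [hset] at hcard
  rw [Finset.sum_congr rfl (g := fun _ => preEnt m μ T ord b t)
    fun g hg => by rw [(Finset.mem_filter.1 hg).2], Finset.sum_const, nsmul_eq_mul]
  refine mul_le_mul_of_nonneg_right ?_ (preEnt_nonneg t)
  have : ((((sphereF r (k + 1)).filter fun g => (firstLetter g)⁻¹ * g = t).card + 1 : ℕ) : ℝ) ≤
    ((2 * r : ℕ) : ℝ) := Nat.cast_le.2 hcard
  push_cast at this
  linarith

variable [IsProbabilityMeasure μ]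

lemma idecay_nonneg (hT : T.Preserves μ) (hm : InvariantSA m T) (hb : Measurable[mX, ⊤] b)
    (hfin : condEntS m μ b ≠ ⊤) {g : FG r} (hg : 1 ≤ wlen g) : 0 ≤ idecay m μ T ord b g := by
  set s := firstLetter g
  have hle : ∀ A : Set (FG r), m ⊔ T.partSA A b ≤ mX := fun A => sup_le hm.1 (partSA_le hb A)
  have htop : ∀ (A : Set (FG r)) (h : FG r), condEntS (m ⊔ T.partSA A b) μ (T.tr h b) ≠ ⊤ := by
    intro A h
    refine ne_top_of_le_ne_top hfin ?_
    rw [← condEntS_tr hT hm hb h]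
    exact condEntS_anti le_sup_left (hle A) (measurable_top_tr hb h)
  refine sub_nonneg.2 (ENNReal.toReal_mono (htop _ _) ?_)
  rw [← condEntS_comp_measurePreserving (hle _) (hT s⁻¹) (measurable_top_tr hb (s⁻¹ * g))]
  have h1 : (fun x => T.tr (s⁻¹ * g) b (T.act s⁻¹ x)) = T.tr g b := by
    funext x
    rw [← tr_smul, mul_inv_cancel_left]
  rw [h1, MeasurableSpace.comap_sup, hm.comap_eq, comap_act_partSA]
  refine condEntS_anti (sup_le_sup_left (iSup₂_le fun h hh => ?_) _) (hle _)
    (measurable_top_tr hb g)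
  exact le_iSup₂_of_le (s * h) (firstLetter_mul_mem_Pre hg hh) le_rfl

variable [StandardBorelSpace X]

/-- The chain rule along the order `wlt` for a downward closed set. -/
lemma jointEnt_eq_sum_preEnt (hT : T.Preserves μ) (hm : InvariantSA m T)
    (hord : Function.Injective ord) (hb : Measurable[mX, ⊤] b) (hfin : condEntS m μ b ≠ ⊤)
    (D : Finset (FG r)) (hD : ∀ g ∈ D, Pre ord g ⊆ D) :
    jointEnt m μ (fun g : FG r => T.tr g b) D = ∑ g ∈ D, preEnt m μ T ord b g := by
  have ho : ∀ g : FG r, Measurable[mX, ⊤] (T.tr g b) := fun g => measurable_top_tr hb g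
  induction D using Finset.strongInduction with
  | H D ih =>
  rcases D.eq_empty_or_nonempty with rfl | hne
  · simp [jointEnt, condEntS_of_subsingleton hm.1]
  obtain ⟨g, hg, hmax⟩ := D.exists_max_image (wkey ord) hne
  have hpre : ∀ h, h ∈ D.erase g ↔ h ∈ Pre ord g := by
    intro h
    rw [Finset.mem_erase]
    constructor
    · rintro ⟨hne, hh⟩
      exact (wlt_iff_wkey_lt hord h g).2
        ((hmax h hh).lt_of_ne fun he => hne (wkey_injective hord he))
    · intro hh
      refine ⟨?_, hD g hg hh⟩
      rintro rfl
      exact lt_irrefl _ ((wlt_iff_wkey_lt hord h h).1 hh)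
  have hch := jointEnt_union (μ := μ) hm.1 ho (fun g => by rwa [condEntS_tr hT hm hb])
    (D.erase g) {g}
  rw [Finset.union_comm, ← Finset.insert_eq, Finset.insert_erase hg, ih _ (Finset.erase_ssubset hg),
    condEntS_tuple_singleton (sup_iSup_comap_le hm.1 ho (· ∈ D.erase g)) ho] at hch
  · rw [hch, ← Finset.sum_erase_add _ _ hg]
    simp only [hpre]
    rfl
  · intro h hh k hk
    refine (hpre k).2 ?_
    rw [hpre] at hh
    exact (wlt_iff_wkey_lt hord k g).2
      (((wlt_iff_wkey_lt hord k h).1 hk).trans ((wlt_iff_wkey_lt hord h g).1 hh))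

lemma sum_sphereF_idecay_le {k : ℕ} (hT : T.Preserves μ) (hm : InvariantSA m T)
    (hord : Function.Injective ord) (hb : Measurable[mX, ⊤] b) (hfin : condEntS m μ b ≠ ⊤) :
    ∑ g ∈ sphereF r (k + 2), idecay m μ T ord b g ≤
      2 * (((1 / 2 - (r : ℝ)) * jointEnt m μ (fun g : FG r => T.tr g b) (ballF r k) +
          jointEnt m μ (fun g : FG r => T.tr g b) (ballF r (k + 1)) / 2) -
        ((1 / 2 - (r : ℝ)) * jointEnt m μ (fun g : FG r => T.tr g b) (ballF r (k + 1)) +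
          jointEnt m μ (fun g : FG r => T.tr g b) (ballF r (k + 2)) / 2)) := by
  have hball : ∀ j, jointEnt m μ (fun g : FG r => T.tr g b) (ballF r j) =
      ∑ g ∈ ballF r j, preEnt m μ T ord b g := fun j => by
    refine jointEnt_eq_sum_preEnt hT hm hord hb hfin _ fun g hg h hh => ?_
    rw [mem_ballF] at hg
    simpa using (Pre_subset_ball ord g hh : wlen h ≤ _).trans hg
  have hstep : ∀ j, jointEnt m μ (fun g : FG r => T.tr g b) (ballF r (j + 1)) =
      jointEnt m μ (fun g : FG r => T.tr g b) (ballF r j) +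
        ∑ g ∈ sphereF r (j + 1), preEnt m μ T ord b g := fun j => by
    rw [hball, hball, ← Finset.sum_union]
    · congr 1
      ext g
      simp only [mem_ballF, Finset.mem_union, mem_sphereF]
      lia
    · rw [Finset.disjoint_left]
      intro g hg
      rw [mem_ballF] at hg
      rw [mem_sphereF]
      lia
  have h1 : ∑ g ∈ sphereF r (k + 2), idecay m μ T ord b g =
      ∑ g ∈ sphereF r (k + 2), preEnt m μ T ord b ((firstLetter g)⁻¹ * g) -
        ∑ g ∈ sphereF r (k + 2), preEnt m μ T ord b g := by
    rw [← Finset.sum_sub_distrib]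
    rfl
  have h2 := sum_preEnt_tail_le (m := m) (μ := μ) (T := T) (ord := ord) (b := b)
    (Nat.le_add_left 1 k)
  have h3 := hstep k
  have h4 := hstep (k + 1)
  rw [add_assoc k 1 1, one_add_one_eq_two] at h2 h4
  rw [← sub_eq_iff_eq_add'] at h3
  rw [← h3] at h2
  rw [h1]
  linarith

/-- Partial sums of the independence decay are controlled by the drop of the functional `F`. -/
lemma sum_idecay_le (hT : T.Preserves μ) (hm : InvariantSA m T) (hord : Function.Injective ord)
    (hb : Measurable[mX, ⊤] b) (hfin : condEntS m μ b ≠ ⊤) (K : ℕ) :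
    ∑ g ∈ (ballF r (K + 1)).filter fun g => 2 ≤ wlen g, idecay m μ T ord b g ≤
      2 * (setF r (jointEnt m μ fun g : FG r => T.tr g b) (ballF r 0) -
        setF r (jointEnt m μ fun g : FG r => T.tr g b) (ballF r (K + 1))) := by
  have hh := invSubmodular_tr hT hm hb hfin
  have h0 := hh.half_nbhd_le_setF (ballF r 0)
  have hK := hh.setF_nbhd_le_half (ballF r K)
  rw [← ballF_succ] at h0 hK
  have key : ∑ g ∈ (ballF r (K + 1)).filter fun g => 2 ≤ wlen g, idecay m μ T ord b g ≤
      2 * (((1 / 2 - (r : ℝ)) * jointEnt m μ (fun g : FG r => T.tr g b) (ballF r 0) +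
          jointEnt m μ (fun g : FG r => T.tr g b) (ballF r (0 + 1)) / 2) -
        ((1 / 2 - (r : ℝ)) * jointEnt m μ (fun g : FG r => T.tr g b) (ballF r K) +
          jointEnt m μ (fun g : FG r => T.tr g b) (ballF r (K + 1)) / 2)) := by
    clear hK
    induction K with
    | zero =>
      rw [Finset.sum_eq_zero]
      · simp
      · intro g hg
        simp only [Finset.mem_filter, mem_ballF] at hg
        lia
    | succ K ih =>
      have hsplit : ((ballF r (K + 1 + 1)).filter fun g => 2 ≤ wlen g) =
          ((ballF r (K + 1)).filter fun g => 2 ≤ wlen g) ∪ sphereF r (K + 2) := by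
        ext g
        simp only [Finset.mem_filter, mem_ballF, Finset.mem_union, mem_sphereF]
        lia
      rw [hsplit, Finset.sum_union]
      · have := sum_sphereF_idecay_le (k := K) hT hm hord hb hfin
        linarith
      · rw [Finset.disjoint_left]
        intro g hg
        simp only [Finset.mem_filter, mem_ballF] at hg
        rw [mem_sphereF]
        lia
  linarith

lemma tsum_idecay_le (hT : T.Preserves μ) (hm : InvariantSA m T) (hord : Function.Injective ord)
    {a : X → ℕ} (ha : Measurable[mX, ⊤] a) (hfin : condEntS m μ a ≠ ⊤) {c : ℝ}
    (hc : ∀ n, c ≤ fSeqRel m μ T a n) (n : ℕ) :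
    ∑' g : {g : FG r // 2 ≤ wlen g},
      ENNReal.ofReal (idecay m μ T ord (T.joinF (ball r n) a) g.1) ≤
        ENNReal.ofReal (2 * (fSeqRel m μ T a n - c)) := by
  have hb := measurable_top_joinF (T := T) ha n
  have hbfin := condEntS_joinF_ne_top hT hm ha hfin n
  rw [ENNReal.tsum_eq_iSup_sum]
  refine iSup_le fun s => ?_
  have hnn : ∀ g : FG r, 2 ≤ wlen g → 0 ≤ idecay m μ T ord (T.joinF (ball r n) a) g :=
    fun g hg => idecay_nonneg hT hm hb hbfin (by lia)
  rw [← ENNReal.ofReal_sum_of_nonneg fun g _ => hnn g.1 g.2]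
  refine ENNReal.ofReal_le_ofReal ?_
  obtain ⟨K, hK⟩ : ∃ K, ∀ g ∈ s, wlen g.1 ≤ K :=
    ⟨s.sup fun g => wlen g.1, fun g hg => Finset.le_sup (f := fun g => wlen g.1) hg⟩
  have h1 : ∑ g ∈ s, idecay m μ T ord (T.joinF (ball r n) a) g.1 ≤
      ∑ g ∈ (ballF r (K + 1)).filter fun g => 2 ≤ wlen g,
        idecay m μ T ord (T.joinF (ball r n) a) g := by
    refine (Finset.sum_map s (Function.Embedding.subtype fun g : FG r => 2 ≤ wlen g)
      (idecay m μ T ord (T.joinF (ball r n) a))).symm.trans_le ?_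
    refine Finset.sum_le_sum_of_subset_of_nonneg ?_
      fun g hg _ => hnn g (Finset.mem_filter.1 hg).2
    intro g hg
    obtain ⟨g, hgs, rfl⟩ := Finset.mem_map.1 hg
    simp only [Function.Embedding.subtype_apply, Finset.mem_filter, mem_ballF]
    exact ⟨(hK g hgs).trans (Nat.le_succ K), g.2⟩
  have h2 := sum_idecay_le hT hm hord hb hbfin K
  rw [← fSeqRel_add hm ha, ← fSeqRel_add hm ha] at h2
  have h3 := hc (n + (K + 1))
  simp only [add_zero] at h2
  linarith

end

end

section

lemma nbhd_image_inl {r : ℕ} (Q : Finset (FG r)) :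
    (nbhd r Q).image (Sum.inl : FG r → FG r ⊕ FG r) = nbhd r (Q.image Sum.inl) := by
  simp only [nbhd, Finset.image_union, Finset.biUnion_image]
  congr 1
  refine Finset.biUnion_congr rfl fun p _ => ?_
  simp only [Finset.smul_finset_def, Finset.image_image]
  rfl

variable {X : Type*} {m : MeasurableSpace X} [mX : MeasurableSpace X] {μ : Measure X}

section

variable {r : ℕ} {T : BorelAction (FG r) X} [StandardBorelSpace X] [IsProbabilityMeasure μ]

/-- A lower bound for the `F`-functionals of a generating partition transfers to every other
partition of finite entropy. -/
lemma exists_le_fSeqRel_of_generating (hT : T.Preserves μ) (hm : InvariantSA m T) {a b : X → ℕ}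
    (ha : Measurable[mX, ⊤] a) (hafin : condEntS m μ a ≠ ⊤) (hgen : T.Generating a μ)
    (hb : Measurable[mX, ⊤] b) (hbfin : condEntS m μ b ≠ ⊤) {c : ℝ}
    (hc : ∀ n, c ≤ fSeqRel m μ T a n) : ∃ d, ∀ n, d ≤ fSeqRel m μ T b n := by
  let o : FG r ⊕ FG r → X → ℕ := Sum.elim (fun g => T.tr g a) (fun g => T.tr g b)
  have ho : ∀ j, Measurable[mX, ⊤] (o j) := by
    rintro (g | g)
    · exact measurable_top_tr ha g
    · exact measurable_top_tr hb g
  have hact : ∀ (g : FG r) j x, o (g • j) x = o j (T.act g⁻¹ x) := by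
    rintro g (j | j) x
    · exact tr_smul a g j x
    · exact tr_smul b g j x
  have hofin : ∀ j, condEntS m μ (o j) ≠ ⊤ := by
    rintro (g | g)
    · exact (condEntS_tr hT hm ha g).trans_ne hafin
    · exact (condEntS_tr hT hm hb g).trans_ne hbfin
  have hh := invSubmodular_jointEnt hT hm ho hofin hact
  let Q : ℕ → Finset (FG r ⊕ FG r) := fun k => (ballF r k).image Sum.inl
  have hQmono : Monotone Q := fun k l hkl => Finset.image_subset_image fun g hg => by
    rw [mem_ballF] at hg ⊢
    exact hg.trans hkl
  have hQsucc : ∀ k, Q (k + 1) = nbhd r (Q k) := fun k => by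
    simp only [Q, ballF_succ, nbhd_image_inl]
  have hFa : ∀ k, fSeqRel m μ T a k = setF r (jointEnt m μ o) (Q k) := fun k =>
    FFrel_eq_setF hm.1 ho hact (measurable_top_joinF ha k) fun x y => by
      simp [joinF_ball_eq_iff, Q, o]
  refine ⟨c - jointEnt m μ o (Q 0), fun n => ?_⟩
  let D : Finset (FG r ⊕ FG r) := (ballF r n).image Sum.inr
  have hFb : fSeqRel m μ T b n = setF r (jointEnt m μ o) D :=
    FFrel_eq_setF hm.1 ho hact (measurable_top_joinF hb n) fun x y => by
      simp [joinF_ball_eq_iff, D, o]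
  have hD : Measurable[mX, ⊤] fun x (j : D) => o j x := measurable_top_pi fun j : D => ho j
  let ℱ : Filtration ℕ mX :=
    { seq := fun k => m ⊔ ⨆ j ∈ Q k, MeasurableSpace.comap (o j) ⊤
      mono' := fun k l hkl => sup_le_sup_left (biSup_mono fun j hj => hQmono hkl hj) _
      le' := fun k => sup_iSup_comap_le hm.1 ho (· ∈ Q k) }
  have hpart : T.partSA Set.univ a ≤ ⨆ k, ℱ k := by
    refine iSup₂_le fun g _ => le_iSup_of_le (wlen g) (le_sup_of_le_right ?_)
    exact le_iSup₂_of_le (f := fun j (_ : j ∈ Q (wlen g)) => MeasurableSpace.comap (o j) ⊤)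
      (Sum.inl g) (Finset.mem_image_of_mem _ (by simp)) le_rfl
  have hlim : Tendsto (fun k => condEntS (ℱ k) μ fun x (j : D) => o j x) atTop (nhds 0) := by
    refine tendsto_condEntS_zero ℱ hD (ne_top_of_le_ne_top
      (condEntS_tuple_ne_top (μ := μ) hm.1 ho hofin D) (condEntS_anti le_sup_left (ℱ.le 0) hD))
      fun i => ?_
    obtain ⟨B', hB', h0⟩ := hgen _ (hD (t := {i}) trivial)
    exact ⟨B', hpart _ hB', h0⟩
  have hdec : ∀ k, setF r (jointEnt m μ o) (D ∪ Q k) ≤ setF r (jointEnt m μ o) (D ∪ Q 0) := by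
    intro k
    induction k with
    | zero => exact le_rfl
    | succ k ih =>
      rw [hQsucc]
      exact (hh.setF_union_nbhd_le D (Q k)).trans ih
  have hbound : ∀ k, c - jointEnt m μ o (Q 0) ≤ fSeqRel m μ T b n +
      (2 * r - 1) * (condEntS (ℱ k) μ fun x (j : D) => o j x).toReal := by
    intro k
    have h1 := hh.setF_le_setF_union D (Q k)
    have h2 := jointEnt_union (μ := μ) hm.1 ho hofin (Q k) D
    have h3 := hh.setF_union_le D (Q 0)
    have h4 := hc k
    rw [Finset.union_comm] at h2
    rw [h2, add_sub_cancel_left, ← hFa] at h1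
    rw [← hFb] at h3
    have h5 := hdec k
    change fSeqRel m μ T a k ≤ _ + (2 * r - 1) * (condEntS (ℱ k) μ _).toReal at h1
    linarith
  have hlim' := (((ENNReal.tendsto_toReal ENNReal.zero_ne_top).comp hlim).const_mul
    (2 * (r : ℝ) - 1)).const_add (fSeqRel m μ T b n)
  simp only [ENNReal.toReal_zero, mul_zero, add_zero] at hlim'
  exact ge_of_tendsto' hlim' hbound

end

end

/-- If the relative f-invariant entropy is finite, the total independence
decay outside the unit ball of the refined partitions `B_n·α` tends to `0`. -/
theorem statement12 {r : ℕ} (hr : 1 ≤ r) {X : Type*}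
    (m : MeasurableSpace X) [mX : MeasurableSpace X] [StandardBorelSpace X]
    (μ : Measure X) [IsProbabilityMeasure μ]
    (T : BorelAction (FG r) X) (hT : T.Preserves μ)
    (hm : InvariantSA m T)
    (ord : Fin r × Bool → ℕ) (hord : Function.Injective ord)
    (hdef : ∃ a : X → ℕ, Measurable a ∧ T.Generating a μ ∧ Hpart μ a < ⊤ ∧
      fInvRel m μ T a ≠ ⊥) :
    ∀ a : X → ℕ, Measurable a → T.Generating a μ → Hpart μ a < ⊤ →
      Filter.Tendsto (fun n : ℕ =>
          ∑' g : {g : FG r // 2 ≤ wlen g},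
            ENNReal.ofReal (idecay m μ T ord (T.joinF (ball r n) a) g.1))
        Filter.atTop (nhds 0) := by
  obtain ⟨a₀, ha₀, hgen₀, hfin₀, hbot⟩ := hdef
  intro a ha _ hfin
  have hmeas : ∀ {b : X → ℕ}, Measurable b → Measurable[mX, ⊤] b := fun hb => hb
  have hne : ∀ {b : X → ℕ}, Measurable b → Hpart μ b < ⊤ → condEntS m μ b ≠ ⊤ := fun hb h =>
    ne_top_of_le_ne_top h.ne (condEntS_le_Hpart hm.1 (hmeas hb))
  have hle : ∀ n, fInvRel m μ T a₀ ≤ (fSeqRel m μ T a₀ n : EReal) := fun n => iInf_le _ n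
  have hc : ∀ n, (fInvRel m μ T a₀).toReal ≤ fSeqRel m μ T a₀ n := fun n =>
    EReal.toReal_le_toReal (hle n) hbot (EReal.coe_ne_top _)
  obtain ⟨d, hd⟩ := exists_le_fSeqRel_of_generating hT hm (hmeas ha₀) (hne ha₀ hfin₀) hgen₀
    (hmeas ha) (hne ha hfin) hc
  have hbdd : BddBelow (Set.range (fSeqRel m μ T a)) := ⟨d, by rintro _ ⟨n, rfl⟩; exact hd n⟩
  have hlim := tendsto_atTop_ciInf (fSeqRel_antitone hT hm (hmeas ha) (hne ha hfin)) hbdd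
  have hupper := ENNReal.tendsto_ofReal
    ((hlim.sub_const (⨅ n, fSeqRel m μ T a n)).const_mul (2 : ℝ))
  rw [sub_self, mul_zero, ENNReal.ofReal_zero] at hupper
  exact tendsto_of_tendsto_of_tendsto_of_le_of_le tendsto_const_nhds hupper
    (fun _ => zero_le) fun n => tsum_idecay_le hT hm hord (hmeas ha) (hne ha hfin)
      (fun k => ciInf_le hbdd k) n

end FPaper
end

section
/- Let G be a free group of finite rank r with free generating set S, acting on a standard Borel probability space (X, μ) by μ-preserving Borel automorphisms. Let M be the set of G-invariant Borel probability measures on X, equipped with the σ-algebra generated by the evaluation maps ν ↦ ν(B) for Borel B ⊆ X, and let τ be a Borel probability measure on M with μ(B) = ∫ ν(B) dτ(ν) for every Borel B, such that for (τ×τ)-almost every pair (m, λ), either m = λ or m and λ are mutually singular (there is a Borel set B with m(B) = 1 and λ(B) = 0). Let α be a countable measurable partition of X. Then: (i) if α is generating for the G-action on (X, μ), then for τ-almost every ν ∈ M, α is generating for the G-action on (X, ν); and (ii) if H_μ(α) < ∞, then H_ν(α) < ∞ for τ-almost every ν ∈ M and ∫ H_ν(α) dτ(ν) ≤ H_μ(α).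 -/
open MeasureTheory Filter Set
open scoped ENNReal symmDiff Pointwise

namespace FPaper

/-- The σ-algebra generated by translates of a measurable partition consists of measurable sets. -/
theorem BorelAction.partSA_le {G X I : Type*} [Group G] [mX : MeasurableSpace X]
    [MeasurableSpace I] [DiscreteMeasurableSpace I] (T : BorelAction G X) (F : Set G) {a : X → I}
    (ha : Measurable a) : T.partSA F a ≤ mX := by
  refine iSup₂_le fun f _ => ?_
  rintro _ ⟨s, -, rfl⟩
  exact (ha.comp (T.measurable_act f⁻¹)) (MeasurableSet.of_discrete (s := s))

/-- To be generating it suffices to approximate the members of a generating family of sets. -/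
theorem BorelAction.generating_of_generateFrom {G X I : Type*} [Group G] [mX : MeasurableSpace X]
    (T : BorelAction G X) (a : X → I) (ν : Measure X) {C : Set (Set X)}
    (hC : mX = MeasurableSpace.generateFrom C)
    (h : ∀ B ∈ C, ∃ B', MeasurableSet[T.partSA Set.univ a] B' ∧ ν (B ∆ B') = 0) :
    T.Generating a ν := by
  intro B hB
  rw [hC] at hB
  induction B, hB using MeasurableSpace.generateFrom_induction with
  | hC t ht _ => exact h t ht
  | empty => exact ⟨∅, @MeasurableSet.empty _ (_), by simp⟩
  | compl t _ ih =>
    obtain ⟨B', hB', h0⟩ := ih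
    refine ⟨B'ᶜ, hB'.compl, ?_⟩
    rwa [compl_symmDiff_compl]
  | iUnion f _ ih =>
    choose B' hB' h0 using ih
    refine ⟨⋃ n, B' n, MeasurableSet.iUnion hB', measure_mono_null ?_ (measure_iUnion_null h0)⟩
    intro x hx
    simp only [Set.mem_symmDiff, Set.mem_iUnion] at hx ⊢
    grind

/-- Almost every component of a decomposition of `μ` inherits a generating partition of `μ`. -/
theorem BorelAction.Generating.ae_of_lintegral {G X I : Type*} [Group G]
    [mX : MeasurableSpace X] [MeasurableSpace.CountablyGenerated X]
    [MeasurableSpace I] [DiscreteMeasurableSpace I] {T : BorelAction G X} {a : X → I}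
    (ha : Measurable a) {μ : Measure X} {τ : Measure (Measure X)}
    (hdec : ∀ B : Set X, MeasurableSet B → μ B = ∫⁻ ν, ν B ∂τ) (hgen : T.Generating a μ) :
    ∀ᵐ ν ∂τ, T.Generating a ν := by
  obtain ⟨C, hCc, hC⟩ := MeasurableSpace.CountablyGenerated.isCountablyGenerated (α := X)
  have hCm : ∀ B ∈ C, MeasurableSet B := fun B hB => by
    rw [hC]
    exact MeasurableSpace.measurableSet_generateFrom hB
  have key : ∀ᵐ ν ∂τ, ∀ B ∈ C,
      ∃ B', MeasurableSet[T.partSA Set.univ a] B' ∧ ν (B ∆ B') = 0 := by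
    refine (ae_ball_iff hCc).2 fun B hB => ?_
    obtain ⟨B', hB', h0⟩ := hgen B (hCm B hB)
    have hm : MeasurableSet (B ∆ B') := (hCm B hB).symmDiff (T.partSA_le _ ha _ hB')
    rw [hdec _ hm, lintegral_eq_zero_iff (Measure.measurable_coe hm)] at h0
    filter_upwards [h0] with ν hν using ⟨B', hB', hν⟩
  filter_upwards [key] with ν hν using T.generating_of_generateFrom a ν hC hν

/-- Jensen's inequality for `x ↦ -x log x` and a random variable with values in `[0, 1]`. -/
theorem lintegral_ofReal_negMulLog_le {Ω : Type*} [MeasurableSpace Ω] (τ : Measure Ω)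
    [IsProbabilityMeasure τ] {f : Ω → ℝ} (hf : Measurable f) (h01 : ∀ᵐ ω ∂τ, f ω ∈ Icc 0 1) :
    ∫⁻ ω, ENNReal.ofReal (Real.negMulLog (f ω)) ∂τ ≤
      ENNReal.ofReal (Real.negMulLog (∫ ω, f ω ∂τ)) := by
  have hfi : Integrable f τ := by
    refine Integrable.of_bound hf.aestronglyMeasurable 1 ?_
    filter_upwards [h01] with ω hω
    rw [Real.norm_of_nonneg hω.1]
    exact hω.2
  have hgi : Integrable (Real.negMulLog ∘ f) τ := by
    refine Integrable.of_bound
      (Real.continuous_negMulLog.measurable.comp hf).aestronglyMeasurable 1 ?_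
    filter_upwards [h01] with ω hω
    rcases hω.1.eq_or_lt with h | h
    · simp [← h]
    · have := Real.abs_log_mul_self_lt (f ω) h hω.2
      rw [Function.comp_apply, Real.negMulLog, Real.norm_eq_abs, neg_mul, abs_neg, mul_comm]
      exact this.le
  have hnn : 0 ≤ᵐ[τ] Real.negMulLog ∘ f := by
    filter_upwards [h01] with ω hω using Real.negMulLog_nonneg hω.1 hω.2
  have h := Real.concaveOn_negMulLog.le_map_integral Real.continuous_negMulLog.continuousOn
    isClosed_Ici (h01.mono fun ω hω => hω.1) hfi hgi
  calc ∫⁻ ω, ENNReal.ofReal (Real.negMulLog (f ω)) ∂τ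
      = ENNReal.ofReal (∫ ω, Real.negMulLog (f ω) ∂τ) :=
        (ofReal_integral_eq_lintegral_ofReal hgi hnn).symm
    _ ≤ _ := ENNReal.ofReal_le_ofReal h

/-- The entropy of a measurable partition depends measurably on the measure. -/
theorem measurable_Hpart {X I : Type*} [MeasurableSpace X] [Countable I] [MeasurableSpace I]
    [MeasurableSingletonClass I] {a : X → I} (ha : Measurable a) :
    Measurable fun ν : Measure X => Hpart ν a :=
  Measurable.tsum fun i => (Real.continuous_negMulLog.measurable.comp
    (Measure.measurable_coe (ha (measurableSet_singleton i))).ennreal_toReal).ennreal_ofReal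

/-- The average entropy over a decomposition of `μ` is at most the entropy of `μ`. -/
theorem lintegral_Hpart_le {X I : Type*} [MeasurableSpace X] [Countable I] [MeasurableSpace I]
    [MeasurableSingletonClass I] {a : X → I} (ha : Measurable a) {μ : Measure X}
    {τ : Measure (Measure X)} [IsProbabilityMeasure τ]
    (hprob : ∀ᵐ ν ∂τ, IsProbabilityMeasure ν)
    (hdec : ∀ B : Set X, MeasurableSet B → μ B = ∫⁻ ν, ν B ∂τ) :
    ∫⁻ ν, Hpart ν a ∂τ ≤ Hpart μ a := by
  have hA : ∀ i, MeasurableSet (a ⁻¹' {i}) := fun i => ha (measurableSet_singleton i)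
  have hm : ∀ i, Measurable fun ν : Measure X => (ν (a ⁻¹' {i})).toReal := fun i =>
    (Measure.measurable_coe (hA i)).ennreal_toReal
  unfold Hpart
  rw [lintegral_tsum (f := fun i (ν : Measure X) =>
    ENNReal.ofReal (Real.negMulLog (ν (a ⁻¹' {i})).toReal)) fun i =>
    (Real.continuous_negMulLog.measurable.comp (hm i)).ennreal_ofReal.aemeasurable]
  refine ENNReal.tsum_le_tsum fun i => ?_
  rw [hdec _ (hA i), ← integral_toReal (Measure.measurable_coe (hA i)).aemeasurable
    (hprob.mono fun ν _ => measure_lt_top ν _)]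
  refine lintegral_ofReal_negMulLog_le τ (hm i) ?_
  filter_upwards [hprob] with ν _
  exact ⟨ENNReal.toReal_nonneg, measureReal_le_one⟩

/-- Lemma `LEM GENERATOR`: decompositions into mutually singular measures
preserve generating partitions and have averaged entropy at most the total entropy. -/
theorem statement15 {r : ℕ} (hr : 1 ≤ r) {X : Type*}
    [mX : MeasurableSpace X] [StandardBorelSpace X]
    (μ : Measure X) [IsProbabilityMeasure μ]
    (T : BorelAction (FG r) X) (hT : T.Preserves μ)
    (τ : Measure (Measure X)) [IsProbabilityMeasure τ]
    (hconc : τ (InvProb T) = 1)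
    (hdec : ∀ B : Set X, MeasurableSet B → μ B = ∫⁻ ν, ν B ∂τ)
    (hsing : ∀ᵐ q ∂(τ.prod τ), q.1 = q.2 ∨
      ∃ B : Set X, MeasurableSet B ∧ q.1 B = 1 ∧ q.2 B = 0)
    (a : X → ℕ) (ha : Measurable a) :
    (T.Generating a μ → ∀ᵐ ν ∂τ, T.Generating a ν) ∧
      (Hpart μ a < ⊤ →
        (∀ᵐ ν ∂τ, Hpart ν a < ⊤) ∧ ∫⁻ ν, Hpart ν a ∂τ ≤ Hpart μ a) := by
  have hprob : ∀ᵐ ν ∂τ, IsProbabilityMeasure ν := by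
    have hms : MeasurableSet {ν : Measure X | ν univ = 1} :=
      Measure.measurable_coe MeasurableSet.univ (measurableSet_singleton 1)
    have h1 : τ {ν : Measure X | ν univ = 1} = 1 :=
      le_antisymm prob_le_one (hconc.symm.le.trans (measure_mono fun ν hν => hν.1.measure_univ))
    filter_upwards [(mem_ae_iff_prob_eq_one hms).2 h1] with ν hν using ⟨hν⟩
  refine ⟨fun hgen => hgen.ae_of_lintegral ha hdec, fun hfin => ?_⟩
  have hle := lintegral_Hpart_le ha hprob hdec
  exact ⟨ae_lt_top (measurable_Hpart ha) (hle.trans_lt hfin).ne, hle⟩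

end FPaper
end
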